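/- arXiv:1011.3198 — 2 statements merged into one kernel-verified Lean document; each statement's English description precedes it below -/
import Mathlib

section
/- Let N be a large integer, let y be an integer with 2 ≤ y ≤ N, and let z = 1/N − 2πiα. Then ∫_{−1/2}^{1/2} T(y; −α) · (S̃(α) − 1/z)/z dα = ∑_{n=1}^{y} e^{−n/N}(ψ(n) − n) + O((yN log N)^{1/2}), with an absolute implied constant. (This statement is unconditional.) -/
open Finset

/-- The von Mangoldt function. -/
noncomputable def vM (n : ℕ) : ℝ := ArithmeticFunction.vonMangoldt n

/-- `z = 1/N - 2πiα`. -/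
noncomputable def zOf (N : ℕ) (α : ℝ) : ℂ :=
  1 / (N : ℂ) - 2 * (Real.pi : ℂ) * Complex.I * (α : ℂ)

/-- The weighted exponential sum `S̃(α) = ∑_{n ≥ 1} Λ(n) e^{-n/N} e(nα)`. -/
noncomputable def Stilde (N : ℕ) (α : ℝ) : ℂ :=
  ∑' n : ℕ, (vM n : ℂ) * Real.exp (-(n : ℝ) / N) *
    Complex.exp (2 * (Real.pi : ℂ) * Complex.I * (n : ℂ) * (α : ℂ))


/-- Chebyshev's function `ψ(n) = ∑_{m ≤ n} Λ(m)`. -/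
noncomputable def psi (n : ℕ) : ℝ := ∑ m ∈ Finset.Icc 1 n, vM m

/-- `T(y; α) = ∑_{n=1}^{y} e(nα)`. -/
noncomputable def T (y : ℕ) (α : ℝ) : ℂ :=
  ∑ n ∈ Finset.Icc 1 y, Complex.exp (2 * (Real.pi : ℂ) * Complex.I * (n : ℂ) * (α : ℂ))

/-- The series `∑_{n ≥ 0} a(n) e(nα)`. -/
noncomputable def expSeries (a : ℕ → ℂ) (α : ℝ) : ℂ :=
  ∑' n : ℕ, a n * Complex.exp (2 * (Real.pi : ℂ) * Complex.I * (n : ℂ) * (α : ℂ))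

lemma norm_exp_two_pi_I_mul (k α : ℝ) :
    ‖Complex.exp (2 * (Real.pi : ℂ) * Complex.I * (k : ℂ) * (α : ℂ))‖ = 1 := by
  rw [show 2 * (Real.pi : ℂ) * Complex.I * (k : ℂ) * (α : ℂ) =
    ((2 * Real.pi * k * α : ℝ) : ℂ) * Complex.I by push_cast; ring]
  exact Complex.norm_exp_ofReal_mul_I _

lemma integral_exp_two_pi_I_int_mul (k : ℤ) :
    ∫ α in (-(1/2 : ℝ))..(1/2 : ℝ),
      Complex.exp (2 * (Real.pi : ℂ) * Complex.I * (k : ℂ) * (α : ℂ)) = if k = 0 then 1 else 0 := by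
  split_ifs with h
  · subst h
    norm_num
  · have hc : 2 * (Real.pi : ℂ) * Complex.I * (k : ℂ) ≠ 0 :=
      mul_ne_zero Complex.two_pi_I_ne_zero (by exact_mod_cast h)
    rw [integral_exp_mul_complex hc, div_eq_zero_iff]
    left
    rw [sub_eq_zero, Complex.exp_eq_exp_iff_exists_int]
    exact ⟨k, by push_cast; ring⟩

lemma integral_tsum_mul_exp {ι : Type*} [Countable ι] (c : ι → ℂ) (k : ι → ℤ)
    (hc : Summable fun i => ‖c i‖) :
    ∫ α in (-(1/2 : ℝ))..(1/2 : ℝ),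
      ∑' i, c i * Complex.exp (2 * (Real.pi : ℂ) * Complex.I * (k i : ℂ) * (α : ℂ)) =
    ∑' i, if k i = 0 then c i else 0 := by
  have h := intervalIntegral.hasSum_integral_of_dominated_convergence
    (μ := MeasureTheory.volume) (a := -(1/2 : ℝ)) (b := 1/2)
    (F := fun i (α : ℝ) => c i * Complex.exp (2 * (Real.pi : ℂ) * Complex.I * (k i : ℂ) * (α : ℂ)))
    (f := fun α : ℝ =>
      ∑' i, c i * Complex.exp (2 * (Real.pi : ℂ) * Complex.I * (k i : ℂ) * (α : ℂ)))
    (fun i _ => ‖c i‖) (fun i => by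
      apply Continuous.aestronglyMeasurable
      fun_prop)
    (fun i => Filter.Eventually.of_forall fun α _ => by
      have := norm_exp_two_pi_I_mul (k i : ℝ) α
      push_cast at this
      simp [this])
    (Filter.Eventually.of_forall fun α _ => hc)
    (by simp)
    (Filter.Eventually.of_forall fun α _ => by
      refine Summable.hasSum (Summable.of_norm_bounded hc fun i => ?_)
      have := norm_exp_two_pi_I_mul (k i : ℝ) α
      push_cast at this
      simp [this])
  rw [← h.tsum_eq]
  refine tsum_congr fun i => ?_
  rw [intervalIntegral.integral_const_mul, integral_exp_two_pi_I_int_mul]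
  simp

lemma summable_norm_mul_exp {a : ℕ → ℂ} (ha : Summable fun n => ‖a n‖) (α : ℝ) :
    Summable fun n : ℕ =>
      ‖a n * Complex.exp (2 * (Real.pi : ℂ) * Complex.I * (n : ℂ) * (α : ℂ))‖ := by
  refine ha.congr fun n => ?_
  have := norm_exp_two_pi_I_mul n α
  push_cast at this
  simp [this]

lemma continuous_expSeries {a : ℕ → ℂ} (ha : Summable fun n => ‖a n‖) :
    Continuous (expSeries a) := by
  refine continuous_tsum (fun n => by fun_prop) ha fun n α => ?_
  have := norm_exp_two_pi_I_mul n α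
  push_cast at this
  simp [this]

lemma integral_exp_neg_mul_expSeries {a : ℕ → ℂ} (ha : Summable fun n => ‖a n‖) (m : ℕ) :
    ∫ α in (-(1/2 : ℝ))..(1/2 : ℝ),
      Complex.exp (2 * (Real.pi : ℂ) * Complex.I * (m : ℂ) * ((-α : ℝ) : ℂ)) * expSeries a α =
    a m := by
  have h := integral_tsum_mul_exp a (fun n => (n : ℤ) - m) ha
  simp only [sub_eq_zero, Nat.cast_inj, tsum_ite_eq] at h
  rw [← h]
  congr 1
  ext α
  rw [expSeries, ← tsum_mul_left]
  refine tsum_congr fun n => ?_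
  rw [mul_left_comm, ← Complex.exp_add]
  congr 2
  push_cast
  ring

lemma integral_norm_sq_expSeries {a : ℕ → ℂ} (ha : Summable fun n => ‖a n‖) :
    ∫ α in (-(1/2 : ℝ))..(1/2 : ℝ), ‖expSeries a α‖ ^ 2 = ∑' n, ‖a n‖ ^ 2 := by
  have ha' : Summable fun n => ‖(starRingEnd ℂ) (a n)‖ := by simpa using ha
  have hs := ha.mul_norm ha'
  have h := integral_tsum_mul_exp (fun p : ℕ × ℕ => a p.1 * (starRingEnd ℂ) (a p.2))
    (fun p => (p.1 : ℤ) - p.2) hs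
  have hL : ∀ α : ℝ, ((‖expSeries a α‖ ^ 2 : ℝ) : ℂ) =
      ∑' p : ℕ × ℕ, a p.1 * (starRingEnd ℂ) (a p.2) *
        Complex.exp (2 * (Real.pi : ℂ) * Complex.I * (((p.1 : ℤ) - p.2 : ℤ) : ℂ) * (α : ℂ)) := by
    intro α
    have h1 := summable_norm_mul_exp ha α
    have h2 : Summable fun n : ℕ => ‖(starRingEnd ℂ)
        (a n * Complex.exp (2 * (Real.pi : ℂ) * Complex.I * (n : ℂ) * (α : ℂ)))‖ := by
      simpa only [RCLike.norm_conj] using h1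
    push_cast
    rw [← Complex.mul_conj', expSeries, Complex.conj_tsum, tsum_mul_tsum_of_summable_norm h1 h2]
    refine tsum_congr fun p => ?_
    rw [map_mul, ← Complex.exp_conj, mul_mul_mul_comm, ← Complex.exp_add]
    congr 2
    simp only [map_mul, Complex.conj_ofReal, Complex.conj_I, map_natCast, Complex.conj_ofNat]
    ring
  have hR : (∑' p : ℕ × ℕ, if (p.1 : ℤ) - p.2 = 0 then a p.1 * (starRingEnd ℂ) (a p.2) else 0) =
      ((∑' n, ‖a n‖ ^ 2 : ℝ) : ℂ) := by
    rw [Summable.tsum_prod]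
    · push_cast
      refine tsum_congr fun n => ?_
      simp only [sub_eq_zero, Nat.cast_inj]
      rw [tsum_eq_single n (fun m hm => if_neg (Ne.symm hm)), if_pos rfl, Complex.mul_conj']
    · refine Summable.of_norm_bounded hs fun p => ?_
      split_ifs
      · exact le_rfl
      · rw [norm_zero]
        positivity
  rw [hR] at h
  have h' := intervalIntegral.integral_ofReal (a := -(1/2 : ℝ)) (b := 1/2)
    (f := fun α => ‖expSeries a α‖ ^ 2) (μ := MeasureTheory.volume)
  simp only [← hL] at h
  exact_mod_cast h'.symm.trans h

lemma expSeries_mul {a b : ℕ → ℂ} (ha : Summable fun n => ‖a n‖) (hb : Summable fun n => ‖b n‖)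
    (α : ℝ) :
    expSeries a α * expSeries b α =
      expSeries (fun n => ∑ p ∈ antidiagonal n, a p.1 * b p.2) α := by
  rw [expSeries, expSeries, tsum_mul_tsum_eq_tsum_sum_antidiagonal_of_summable_norm
    (summable_norm_mul_exp ha α) (summable_norm_mul_exp hb α)]
  refine tsum_congr fun n => ?_
  rw [sum_mul]
  refine sum_congr rfl fun p hp => ?_
  rw [← mem_antidiagonal.mp hp, mul_mul_mul_comm, ← Complex.exp_add]
  congr 2
  push_cast
  ring

lemma integral_norm_sq_T_neg (y : ℕ) :
    ∫ α in (-(1/2 : ℝ))..(1/2 : ℝ), ‖T y (-α)‖ ^ 2 = y := by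
  let a : ℕ → ℂ := fun n => if n ∈ Icc 1 y then 1 else 0
  have ha : Summable fun n => ‖a n‖ :=
    summable_of_ne_finset_zero (s := Icc 1 y) fun n hn => by simp only [a, if_neg hn, norm_zero]
  have hT : ∀ α, T y α = expSeries a α := fun α => by
    rw [T, expSeries, tsum_eq_sum (s := Icc 1 y)]
    · exact sum_congr rfl fun n hn => by simp only [a, if_pos hn, one_mul]
    · intro n hn
      simp only [a, if_neg hn, zero_mul]
  have h := integral_norm_sq_expSeries ha
  rw [tsum_eq_sum (s := Icc 1 y)
    (fun n hn => by simp only [a, if_neg hn, norm_zero, zero_pow two_ne_zero])] at h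
  rw [sum_congr rfl (g := fun _ => (1 : ℝ)) (fun n hn => by simp only [a, if_pos hn]; norm_num)] at h
  simp only [← hT] at h
  rw [intervalIntegral.integral_comp_neg (fun α => ‖T y α‖ ^ 2), neg_neg, h]
  simp

lemma sum_mul_pow_le_sum_mul_pow {u v : ℕ → ℝ} {r : ℝ} (hr0 : 0 ≤ r) (hr1 : r ≤ 1)
    (h : ∀ M, ∑ k ∈ range M, u k ≤ ∑ k ∈ range M, v k) (M : ℕ) :
    ∑ k ∈ range M, u k * r ^ k ≤ ∑ k ∈ range M, v k * r ^ k := by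
  have key : ∀ w : ℕ → ℝ, ∑ k ∈ range M, w k * r ^ k =
      (∑ k ∈ range M, w k) * r ^ M +
        ∑ k ∈ range M, (∑ j ∈ range (k + 1), w j) * (r ^ k * (1 - r)) := by
    intro w
    induction M with
    | zero => simp
    | succ M ih =>
      rw [sum_range_succ, ih, sum_range_succ _ M, sum_range_succ _ M]
      rw [sum_range_succ w M]
      ring
  rw [key u, key v]
  have : 0 ≤ 1 - r := by linarith
  refine add_le_add (mul_le_mul_of_nonneg_right (h M) (by positivity))
    (sum_le_sum fun k _ => mul_le_mul_of_nonneg_right (h (k + 1)) (by positivity))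

lemma vM_nonneg (n : ℕ) : 0 ≤ vM n := ArithmeticFunction.vonMangoldt_nonneg

lemma vM_zero : vM 0 = 0 := by simp [vM]

lemma vM_le_log (n : ℕ) : vM n ≤ Real.log n := ArithmeticFunction.vonMangoldt_le_log

lemma psi_eq_sum_range (n : ℕ) : psi n = ∑ k ∈ range (n + 1), vM k := by
  rw [sum_range_succ', vM_zero, add_zero, psi, ← Finset.Ico_succ_right_eq_Icc, sum_Ico_eq_sum_range]
  simp [add_comm]

lemma sum_range_vM_le (M : ℕ) : ∑ k ∈ range M, vM k ≤ ∑ _k ∈ range M, 6 := by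
  cases M with
  | zero => simp
  | succ M =>
    have h := Chebyshev.psi_le_const_mul_self (x := M) (by positivity)
    rw [Chebyshev.psi_eq_sum_Icc] at h
    rw [Nat.floor_natCast, ← Nat.range_succ_eq_Icc_zero] at h
    have h4 : Real.log 4 ≤ 2 := by
      rw [show (4 : ℝ) = 2 ^ 2 by norm_num, Real.log_pow]
      have := Real.log_two_lt_d9
      push_cast
      linarith
    calc ∑ k ∈ range (M + 1), vM k ≤ (Real.log 4 + 4) * M := h
      _ ≤ 6 * M := by gcongr; linarith
      _ ≤ _ := by simp; linarith

lemma inv_one_sub_exp_neg_le {N : ℕ} (hN : 1 ≤ N) : (1 - Real.exp (-(1 / N : ℝ)))⁻¹ ≤ 2 * N := by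
  have hN' : (1 : ℝ) ≤ N := by exact_mod_cast hN
  have h1 : (1 / N : ℝ) + 1 ≤ Real.exp (1 / N) := Real.add_one_le_exp _
  have h2 : Real.exp (-(1 / N : ℝ)) ≤ ((1 / N : ℝ) + 1)⁻¹ := by
    rw [Real.exp_neg]
    exact inv_anti₀ (by positivity) h1
  have h3 : (1 / (2 * N) : ℝ) ≤ 1 - ((1 / N : ℝ) + 1)⁻¹ := by
    rw [show 1 - ((1 / N : ℝ) + 1)⁻¹ = 1 / (1 + N) by field_simp; ring]
    gcongr
    linarith
  rw [← one_div_one_div (2 * N : ℝ), one_div (1 / (2 * N : ℝ))]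
  exact inv_anti₀ (by positivity) (by linarith)

lemma sum_range_exp_neg_pow_le {N : ℕ} (hN : 1 ≤ N) (M : ℕ) :
    ∑ k ∈ range M, Real.exp (-(1 / N : ℝ)) ^ k ≤ 2 * N := by
  have hN' : (0 : ℝ) < N := by exact_mod_cast hN
  have h1 : Real.exp (-(1 / N : ℝ)) < 1 := by
    rw [Real.exp_lt_one_iff, neg_lt_zero]
    positivity
  refine le_trans ?_ (inv_one_sub_exp_neg_le hN)
  rw [← tsum_geometric_of_lt_one (by positivity) h1]
  exact (summable_geometric_of_lt_one (by positivity) h1).sum_le_tsum _ fun _ _ => by positivity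

lemma exp_neg_div_eq_pow (N n : ℕ) : Real.exp (-(n : ℝ) / N) = Real.exp (-(1 / N : ℝ)) ^ n := by
  rw [← Real.exp_nat_mul]
  congr 1
  ring

lemma vM_sq_mul_pow_le {N : ℕ} (hN : 1 ≤ Real.log N) (n : ℕ) :
    vM n ^ 2 * (Real.exp (-(1 / N : ℝ)) ^ n) ^ 2 ≤
      Real.log N * (vM n * Real.exp (-(1 / N : ℝ)) ^ n) := by
  rcases Nat.eq_zero_or_pos n with rfl | hn
  · simp [vM_zero]
  have hN0 : (0 : ℝ) < N := by
    rcases Nat.eq_zero_or_pos N with rfl | h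
    · norm_num at hN
    · exact_mod_cast h
  have hn0 : (0 : ℝ) < n := by exact_mod_cast hn
  have h1 : vM n ≤ Real.log N * (1 + n / N) := by
    have h2 : Real.log n = Real.log N + Real.log (n / N) := by
      rw [← Real.log_mul (by positivity) (by positivity)]
      congr 1
      field_simp
    have h3 : Real.log (n / N : ℝ) ≤ n / N := Real.log_le_self (by positivity)
    have h4 : (n / N : ℝ) ≤ Real.log N * (n / N) := le_mul_of_one_le_left (by positivity) hN
    linarith [vM_le_log n]
  have h5 : (1 + n / N : ℝ) * Real.exp (-(1 / N : ℝ)) ^ n ≤ 1 := by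
    rw [← exp_neg_div_eq_pow, neg_div, Real.exp_neg, ← div_eq_mul_inv, div_le_one (by positivity),
      add_comm]
    exact Real.add_one_le_exp _
  have := vM_nonneg n
  set ρ := Real.exp (-(1 / N : ℝ)) ^ n
  have hρ : 0 ≤ ρ := by positivity
  calc vM n ^ 2 * ρ ^ 2 = (vM n * ρ) * (vM n * ρ) := by ring
    _ ≤ (vM n * ρ) * (Real.log N * (1 + n / N) * ρ) := by gcongr
    _ = (vM n * ρ) * Real.log N * ((1 + n / N) * ρ) := by ring
    _ ≤ (vM n * ρ) * Real.log N * 1 := by gcongr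
    _ = _ := by ring

/-- The coefficients of `S̃(α) - ∑_{n ≥ 1} e^{-n/N} e(nα)`. -/
noncomputable def centredCoeff (N n : ℕ) : ℝ :=
  (vM n - if n = 0 then 0 else 1) * Real.exp (-(1 / N : ℝ)) ^ n

lemma tsum_centredCoeff_sq_le {N : ℕ} (hN1 : 1 ≤ N) (hN : 1 ≤ Real.log N) :
    ∑' n, centredCoeff N n ^ 2 ≤ 14 * (N * Real.log N) := by
  set r := Real.exp (-(1 / N : ℝ)) with hr
  have hr0 : 0 ≤ r := by positivity
  have hr1 : r ≤ 1 := by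
    rw [hr, Real.exp_le_one_iff, neg_nonpos]
    positivity
  refine Real.tsum_le_of_sum_range_le (fun n => sq_nonneg _) fun M => ?_
  have hterm : ∀ n, centredCoeff N n ^ 2 ≤ Real.log N * (vM n * r ^ n) + r ^ n := by
    intro n
    have h1 := vM_sq_mul_pow_le hN n
    have hv := vM_nonneg n
    have h2 : (vM n - if n = 0 then 0 else 1) ^ 2 ≤ vM n ^ 2 + 1 := by
      split_ifs <;> nlinarith
    have h3 : (r ^ n) ^ 2 ≤ r ^ n := by
      rw [sq]
      exact mul_le_of_le_one_left (by positivity) (pow_le_one₀ hr0 hr1)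
    rw [centredCoeff, mul_pow]
    calc _ ≤ (vM n ^ 2 + 1) * (r ^ n) ^ 2 := by gcongr
      _ = vM n ^ 2 * (r ^ n) ^ 2 + (r ^ n) ^ 2 := by ring
      _ ≤ _ := add_le_add h1 h3
  have hg := sum_range_exp_neg_pow_le hN1 M
  have hv := sum_mul_pow_le_sum_mul_pow hr0 hr1 sum_range_vM_le M
  rw [← mul_sum] at hv
  calc _ ≤ ∑ n ∈ range M, (Real.log N * (vM n * r ^ n) + r ^ n) := sum_le_sum fun n _ => hterm n
    _ = Real.log N * ∑ n ∈ range M, vM n * r ^ n + ∑ n ∈ range M, r ^ n := by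
      rw [sum_add_distrib, mul_sum]
    _ ≤ Real.log N * (6 * (2 * N)) + 2 * N * Real.log N := by
      have h6 : ∑ n ∈ range M, vM n * r ^ n ≤ 6 * (2 * N) := hv.trans (by gcongr)
      have h7 : (2 * N : ℝ) ≤ 2 * N * Real.log N := le_mul_of_one_le_right (by positivity) hN
      gcongr
      exact hg.trans h7
    _ = _ := by ring

lemma summable_norm_vM_mul_pow {r : ℝ} (hr0 : 0 ≤ r) (hr1 : r < 1) :
    Summable fun n : ℕ => ‖((vM n * r ^ n : ℝ) : ℂ)‖ := by
  have h := summable_pow_mul_geometric_of_norm_lt_one 1 (r := r)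
    (by rwa [Real.norm_of_nonneg hr0])
  refine Summable.of_nonneg_of_le (fun _ => norm_nonneg _) (fun n => ?_) h
  have := vM_nonneg n
  rw [Complex.norm_real, Real.norm_of_nonneg (by positivity), pow_one]
  gcongr
  exact (vM_le_log n).trans (Real.log_le_self (by positivity))

lemma norm_exp_neg_sub_one_add_le {z : ℂ} (hz : 0 ≤ z.re) :
    ‖Complex.exp (-z) - 1 + z‖ ≤ 3 * ‖z‖ ^ 2 := by
  rcases le_or_gt ‖z‖ 1 with h | h
  · have := Complex.norm_exp_sub_one_sub_id_le (x := -z) (by simpa using h)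
    rw [norm_neg, sub_neg_eq_add] at this
    nlinarith [sq_nonneg ‖z‖]
  · have h1 : ‖Complex.exp (-z)‖ ≤ 1 := by
      rw [Complex.norm_exp, Real.exp_le_one_iff]
      simpa using hz
    calc _ ≤ ‖Complex.exp (-z)‖ + ‖(1 : ℂ)‖ + ‖z‖ := norm_add_le_of_le (norm_sub_le _ _) le_rfl
      _ ≤ 1 + 1 + ‖z‖ := by gcongr; simp
      _ ≤ _ := by nlinarith

lemma norm_sq_le_norm_one_sub_exp_neg_sq {z : ℂ} (hz0 : 0 ≤ z.re) (hz1 : z.re ≤ 1)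
    (hz : |z.im| ≤ Real.pi) : ‖z‖ ^ 2 ≤ 10 * ‖1 - Complex.exp (-z)‖ ^ 2 := by
  obtain ⟨x, θ⟩ := z
  simp only at hz0 hz1 hz
  rw [Complex.sq_norm, Complex.sq_norm, Complex.normSq_apply, Complex.normSq_apply]
  simp only [Complex.sub_re, Complex.sub_im, Complex.one_re, Complex.one_im, Complex.exp_re,
    Complex.exp_im, Complex.neg_re, Complex.neg_im, Real.cos_neg, Real.sin_neg]
  set ρ := Real.exp (-x) with hρ
  have hcos := Real.cos_le_one_sub_mul_cos_sq hz
  have hsc := Real.sin_sq_add_cos_sq θ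
  have hρ1 : x / 2 ≤ 1 - ρ := by
    have h1 : ρ ≤ (x + 1)⁻¹ := by
      rw [hρ, Real.exp_neg]
      exact inv_anti₀ (by positivity) (Real.add_one_le_exp x)
    have h2 : (x + 1)⁻¹ ≤ 1 - x / 2 := by
      rw [inv_le_iff_one_le_mul₀ (by positivity)]
      nlinarith
    linarith
  have hρ2 : 0.36 ≤ ρ := by
    have h1 : Real.exp (-1) ≤ ρ := Real.exp_le_exp.mpr (by linarith)
    have h2 : (0.36 : ℝ) ≤ Real.exp (-1) := by
      rw [Real.exp_neg, le_inv_comm₀ (by norm_num) (by positivity)]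
      have := Real.exp_one_lt_d9
      norm_num at this ⊢
      linarith
    linarith
  have hpi : (0.2 : ℝ) ≤ 2 / Real.pi ^ 2 := by
    rw [le_div_iff₀ (by positivity)]
    nlinarith [Real.pi_lt_d2, Real.pi_pos]
  have hc' : 0.2 * θ ^ 2 ≤ 1 - Real.cos θ := by nlinarith [sq_nonneg θ]
  have h1 : (x / 2) ^ 2 ≤ (1 - ρ) ^ 2 := by gcongr
  have h2 : 0.36 * (0.2 * θ ^ 2) ≤ ρ * (1 - Real.cos θ) := by gcongr
  have h3 : (1 - ρ * Real.cos θ) * (1 - ρ * Real.cos θ) +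
      (0 - ρ * -Real.sin θ) * (0 - ρ * -Real.sin θ) =
      (1 - ρ) ^ 2 + 2 * (ρ * (1 - Real.cos θ)) := by
    linear_combination ρ ^ 2 * hsc
  rw [h3]
  nlinarith [sq_nonneg x, sq_nonneg θ]

lemma norm_one_div_sub_inv_one_sub_exp_neg_le {z : ℂ} (hz0 : 0 < z.re) (hz1 : z.re ≤ 1)
    (hz : |z.im| ≤ Real.pi) : ‖1 / z - (1 - Complex.exp (-z))⁻¹‖ ≤ 10 := by
  have hzne : z ≠ 0 := by
    rintro rfl
    simp at hz0
  have hzpos : 0 < ‖z‖ := norm_pos_iff.mpr hzne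
  have h1 := norm_exp_neg_sub_one_add_le hz0.le
  have h2 := norm_sq_le_norm_one_sub_exp_neg_sq hz0.le hz1 hz
  set D := 1 - Complex.exp (-z) with hD
  have hDpos : 0 < ‖D‖ := by
    rw [norm_pos_iff]
    intro h
    rw [h] at h2
    norm_num at h2
    exact hzne h2
  have hDne : D ≠ 0 := norm_pos_iff.mp hDpos
  have h3 : 1 / z - D⁻¹ = -(Complex.exp (-z) - 1 + z) / (z * D) := by
    field_simp
    rw [hD]
    ring
  rw [h3, norm_div, norm_neg, norm_mul, div_le_iff₀ (by positivity)]
  have h4 : 3 * ‖z‖ ≤ 10 * ‖D‖ := by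
    refine le_of_sq_le_sq ?_ (by positivity)
    nlinarith
  nlinarith

lemma summable_norm_centredCoeff {N : ℕ} (hN : 1 ≤ N) :
    Summable fun n => ‖(centredCoeff N n : ℂ)‖ := by
  have hr1 : Real.exp (-(1 / N : ℝ)) < 1 := by
    rw [Real.exp_lt_one_iff, neg_lt_zero]
    positivity
  have h := summable_norm_vM_mul_pow (by positivity) hr1
  refine Summable.of_nonneg_of_le (fun _ => norm_nonneg _) (fun n => ?_)
    (h.add (summable_geometric_of_lt_one (by positivity) hr1))
  have h1 : |(if n = 0 then 0 else 1 : ℝ)| ≤ 1 := by split_ifs <;> simp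
  rw [centredCoeff, sub_mul, Complex.ofReal_sub]
  refine (norm_sub_le _ _).trans (add_le_add_right ?_ _)
  rw [Complex.norm_real, norm_mul, Real.norm_eq_abs, Real.norm_of_nonneg (by positivity)]
  exact mul_le_of_le_one_left (by positivity) h1

lemma summable_norm_exp_neg_pow {N : ℕ} (hN : 1 ≤ N) :
    Summable fun n : ℕ => ‖((Real.exp (-(1 / N : ℝ)) ^ n : ℝ) : ℂ)‖ := by
  have hr1 : Real.exp (-(1 / N : ℝ)) < 1 := by
    rw [Real.exp_lt_one_iff, neg_lt_zero]
    positivity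
  refine (summable_geometric_of_lt_one (by positivity) hr1).congr fun n => ?_
  rw [Complex.norm_real, Real.norm_of_nonneg (by positivity)]

lemma expSeries_exp_neg_pow {N : ℕ} (hN : 1 ≤ N) (α : ℝ) :
    expSeries (fun n => ((Real.exp (-(1 / N : ℝ)) ^ n : ℝ) : ℂ)) α =
      (1 - Complex.exp (-zOf N α))⁻¹ := by
  rw [expSeries, ← tsum_geometric_of_norm_lt_one]
  · refine tsum_congr fun n => ?_
    rw [← Complex.exp_nat_mul, zOf]
    push_cast
    rw [← Complex.exp_nat_mul, ← Complex.exp_add]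
    congr 1
    ring
  · rw [Complex.norm_exp, Real.exp_lt_one_iff]
    have : (zOf N α).re = 1 / N := by simp [zOf]
    rw [Complex.neg_re, this, neg_lt_zero]
    positivity

lemma Stilde_sub_expSeries {N : ℕ} (hN : 1 ≤ N) (α : ℝ) :
    Stilde N α - (expSeries (fun n => ((Real.exp (-(1 / N : ℝ)) ^ n : ℝ) : ℂ)) α - 1) =
      expSeries (fun n => (centredCoeff N n : ℂ)) α := by
  have hr1 : Real.exp (-(1 / N : ℝ)) < 1 := by
    rw [Real.exp_lt_one_iff, neg_lt_zero]
    positivity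
  have hv := (summable_norm_mul_exp (summable_norm_vM_mul_pow (by positivity) hr1) α).of_norm
  have hd := (summable_norm_mul_exp (summable_norm_centredCoeff hN) α).of_norm
  have hg := (summable_norm_mul_exp (summable_norm_exp_neg_pow hN) α).of_norm
  have h0 : Summable fun n : ℕ =>
      (((if n = 0 then 0 else 1) * Real.exp (-(1 / N : ℝ)) ^ n : ℝ) : ℂ) *
        Complex.exp (2 * (Real.pi : ℂ) * Complex.I * (n : ℂ) * (α : ℂ)) := by
    refine (hv.sub hd).congr fun n => ?_
    rw [← sub_mul, centredCoeff]
    push_cast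
    ring
  have h1 : expSeries (fun n => ((Real.exp (-(1 / N : ℝ)) ^ n : ℝ) : ℂ)) α - 1 =
      ∑' n : ℕ, (((if n = 0 then 0 else 1) * Real.exp (-(1 / N : ℝ)) ^ n : ℝ) : ℂ) *
        Complex.exp (2 * (Real.pi : ℂ) * Complex.I * (n : ℂ) * (α : ℂ)) := by
    rw [expSeries, hg.tsum_eq_zero_add, h0.tsum_eq_zero_add]
    simp
  rw [sub_eq_iff_eq_add, h1, expSeries, ← hd.tsum_add h0, Stilde]
  refine tsum_congr fun n => ?_
  rw [← add_mul, centredCoeff, exp_neg_div_eq_pow]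
  push_cast
  ring

lemma sum_antidiagonal_centredCoeff (N n : ℕ) :
    ∑ p ∈ antidiagonal n, centredCoeff N p.1 * Real.exp (-(1 / N : ℝ)) ^ p.2 =
      Real.exp (-(n : ℝ) / N) * (psi n - n) := by
  have h : ∀ p ∈ antidiagonal n, centredCoeff N p.1 * Real.exp (-(1 / N : ℝ)) ^ p.2 =
      (vM p.1 - if p.1 = 0 then 0 else 1) * Real.exp (-(1 / N : ℝ)) ^ n := fun p hp => by
    rw [← mem_antidiagonal.mp hp, centredCoeff, pow_add]
    ring
  rw [sum_congr rfl h, ← sum_mul, exp_neg_div_eq_pow,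
    Finset.Nat.sum_antidiagonal_eq_sum_range_succ_mk, sum_sub_distrib, ← psi_eq_sum_range,
    sum_range_succ']
  simp [mul_comm]

lemma integral_T_neg_mul_expSeries {a : ℕ → ℂ} (ha : Summable fun n => ‖a n‖) (y : ℕ) :
    ∫ α in (-(1/2 : ℝ))..(1/2 : ℝ), T y (-α) * expSeries a α = ∑ n ∈ Icc 1 y, a n := by
  simp only [T, sum_mul]
  rw [intervalIntegral.integral_finsetSum]
  · exact sum_congr rfl fun n _ => integral_exp_neg_mul_expSeries ha n
  · intro n _
    have := continuous_expSeries ha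
    exact Continuous.intervalIntegrable (by fun_prop) _ _

lemma continuous_T_neg (y : ℕ) : Continuous fun α : ℝ => T y (-α) := by
  unfold T
  fun_prop

lemma norm_sub_mul_div_sub_mul_le {S G w : ℂ} (hw : ‖1 / w - G‖ ≤ 10) :
    ‖(S - 1 / w) / w - (S - (G - 1)) * G‖ ≤ 10 * ‖S - (G - 1)‖ + 110 + 11 * ‖G‖ := by
  have h1 : (S - 1 / w) / w - (S - (G - 1)) * G =
      (S - (G - 1)) * (1 / w - G) - (1 / w - G + 1) * (1 / w - G) - (1 / w - G + 1) * G := by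
    ring
  have h2 : ‖1 / w - G + 1‖ ≤ 11 := by
    refine (norm_add_le _ _).trans ?_
    rw [norm_one]
    linarith
  rw [h1]
  refine (norm_sub_le _ _).trans (add_le_add ((norm_sub_le _ _).trans (add_le_add ?_ ?_)) ?_)
  · rw [norm_mul, mul_comm]
    gcongr
  · rw [norm_mul]
    calc _ ≤ (11 : ℝ) * 10 := by gcongr
      _ = 110 := by norm_num
  · rw [norm_mul]
    gcongr

/-- Cauchy–Schwarz in weighted form, for a factor bounded by a sum of three terms. -/
lemma norm_integral_mul_le_of_norm_le {f g u v : ℝ → ℂ} (hf : Continuous f)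
    (hu : Continuous u) (hv : Continuous v) {t : ℝ} (ht : 0 < t)
    (hg : ∀ α ∈ Set.Ioc (-(1/2 : ℝ)) (1/2), ‖g α‖ ≤ 10 * ‖u α‖ + 110 + 11 * ‖v α‖) :
    ‖∫ α in (-(1/2 : ℝ))..(1/2 : ℝ), f α * g α‖ ≤
      t / 2 * (∫ α in (-(1/2 : ℝ))..(1/2 : ℝ), ‖f α‖ ^ 2) +
      3 / (2 * t) * (100 * (∫ α in (-(1/2 : ℝ))..(1/2 : ℝ), ‖u α‖ ^ 2) + 12100 +
        121 * ∫ α in (-(1/2 : ℝ))..(1/2 : ℝ), ‖v α‖ ^ 2) := by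
  have hint : ∀ w : ℝ → ℂ, Continuous w → IntervalIntegrable (fun α => ‖w α‖ ^ 2)
      MeasureTheory.volume (-(1/2 : ℝ)) (1/2) := fun w hw =>
    Continuous.intervalIntegrable (by fun_prop) _ _
  have hR : IntervalIntegrable (fun α => t / 2 * ‖f α‖ ^ 2 + 3 / (2 * t) *
      (100 * ‖u α‖ ^ 2 + 12100 + 121 * ‖v α‖ ^ 2)) MeasureTheory.volume (-(1/2 : ℝ)) (1/2) :=
    Continuous.intervalIntegrable (by fun_prop) _ _
  refine (intervalIntegral.norm_integral_le_of_norm_le (by norm_num)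
    (Filter.Eventually.of_forall fun α hα => ?_) hR).trans (le_of_eq ?_)
  · rw [norm_mul]
    set F := ‖f α‖
    set U := ‖u α‖
    set V := ‖v α‖
    have hsq : ‖g α‖ ^ 2 ≤ 3 * (100 * U ^ 2 + 12100 + 121 * V ^ 2) := by
      have h1 : ‖g α‖ ^ 2 ≤ (10 * U + 110 + 11 * V) ^ 2 := by
        gcongr
        exact hg α hα
      nlinarith [sq_nonneg (10 * U - 110), sq_nonneg (10 * U - 11 * V), sq_nonneg (110 - 11 * V)]
    have hAG : F * ‖g α‖ ≤ t / 2 * F ^ 2 + 1 / (2 * t) * ‖g α‖ ^ 2 := by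
      have h2 : t / 2 * F ^ 2 + 1 / (2 * t) * ‖g α‖ ^ 2 - F * ‖g α‖ =
          1 / (2 * t) * (t * F - ‖g α‖) ^ 2 := by
        field_simp
        ring
      have h3 : 0 ≤ 1 / (2 * t) * (t * F - ‖g α‖) ^ 2 := by positivity
      linarith
    calc _ ≤ _ := hAG
      _ ≤ t / 2 * F ^ 2 + 1 / (2 * t) * (3 * (100 * U ^ 2 + 12100 + 121 * V ^ 2)) := by gcongr
      _ = _ := by ring
  · have h1 := hint f hf
    have h2 := hint u hu
    have h3 := hint v hv
    rw [intervalIntegral.integral_add (h1.const_mul _)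
        ((((h2.const_mul _).add (by simp)).add (h3.const_mul _)).const_mul _),
      intervalIntegral.integral_const_mul, intervalIntegral.integral_const_mul,
      intervalIntegral.integral_add ((h2.const_mul _).add (by simp)) (h3.const_mul _),
      intervalIntegral.integral_add (h2.const_mul _) (by simp),
      intervalIntegral.integral_const_mul, intervalIntegral.integral_const_mul]
    norm_num

lemma norm_one_div_zOf_sub_expSeries_le {N : ℕ} (hN : 1 ≤ N) {α : ℝ}
    (hα : α ∈ Set.Ioc (-(1/2 : ℝ)) (1/2)) :
    ‖1 / zOf N α - expSeries (fun n => ((Real.exp (-(1 / N : ℝ)) ^ n : ℝ) : ℂ)) α‖ ≤ 10 := by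
  have hre : (zOf N α).re = 1 / N := by simp [zOf]
  have him : (zOf N α).im = -(2 * Real.pi * α) := by simp [zOf]
  rw [expSeries_exp_neg_pow hN]
  refine norm_one_div_sub_inv_one_sub_exp_neg_le ?_ ?_ ?_
  · rw [hre]
    positivity
  · rw [hre, div_le_one (by positivity)]
    exact_mod_cast hN
  · rw [him, abs_neg, abs_le]
    constructor <;> nlinarith [hα.1, hα.2, Real.pi_pos]

theorem I2_lemma :
    ∃ C : ℝ, 0 < C ∧ ∃ N₀ : ℕ, ∀ N : ℕ, N₀ ≤ N → ∀ y : ℕ, 2 ≤ y → y ≤ N →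
      ‖(∫ α in (-(1/2 : ℝ))..(1/2 : ℝ),
            T y (-α) * (Stilde N α - 1 / zOf N α) / zOf N α) -
          ((∑ n ∈ Finset.Icc 1 y, Real.exp (-(n : ℝ) / N) * (psi n - n) : ℝ) : ℂ)‖
        ≤ C * Real.sqrt (y * N * Real.log N) := by
  refine ⟨21000, by norm_num, 3, fun N hN y hy _ => ?_⟩
  have hN1 : 1 ≤ N := by omega
  have hNR : (3 : ℝ) ≤ N := by exact_mod_cast hN
  have hyR : (2 : ℝ) ≤ y := by exact_mod_cast hy
  have hlog : 1 ≤ Real.log N := by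
    rw [Real.le_log_iff_exp_le (by positivity)]
    linarith [Real.exp_one_lt_d9]
  set d : ℕ → ℂ := fun n => (centredCoeff N n : ℂ) with hd
  set g : ℕ → ℂ := fun n => ((Real.exp (-(1 / N : ℝ)) ^ n : ℝ) : ℂ) with hg
  have hds : Summable fun n => ‖d n‖ := summable_norm_centredCoeff hN1
  have hgs : Summable fun n => ‖g n‖ := summable_norm_exp_neg_pow hN1
  have hS : ∀ α, Stilde N α = expSeries d α + (expSeries g α - 1) := fun α => by
    rw [← Stilde_sub_expSeries hN1 α]
    ring
  have hdc := continuous_expSeries hds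
  have hgc := continuous_expSeries hgs
  have hTc := continuous_T_neg y
  have hzc : Continuous (zOf N) := by
    unfold zOf
    fun_prop
  have hzne : ∀ α, zOf N α ≠ 0 := fun α h => by
    have := congrArg Complex.re h
    simp [zOf] at this
    omega
  have hSc : Continuous (Stilde N) := by
    rw [funext hS]
    fun_prop
  have hmain : ∫ α in (-(1/2 : ℝ))..(1/2 : ℝ), T y (-α) * (expSeries d α * expSeries g α) =
      ((∑ n ∈ Finset.Icc 1 y, Real.exp (-(n : ℝ) / N) * (psi n - n) : ℝ) : ℂ) := by
    simp only [expSeries_mul hds hgs]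
    rw [integral_T_neg_mul_expSeries (summable_norm_sum_mul_antidiagonal_of_summable_norm hds hgs),
      Complex.ofReal_sum]
    refine sum_congr rfl fun n _ => ?_
    rw [← sum_antidiagonal_centredCoeff]
    push_cast
    simp [hd, hg]
  set L := (N : ℝ) * Real.log N with hL
  have hNL : (N : ℝ) ≤ L := le_mul_of_one_le_right (by positivity) hlog
  have hLpos : 0 < L := by linarith
  have hbd : ∫ α in (-(1/2 : ℝ))..(1/2 : ℝ), ‖expSeries d α‖ ^ 2 ≤ 14 * L := by
    rw [integral_norm_sq_expSeries hds]
    simpa [hd] using tsum_centredCoeff_sq_le hN1 hlog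
  have hbg : ∫ α in (-(1/2 : ℝ))..(1/2 : ℝ), ‖expSeries g α‖ ^ 2 ≤ 2 * L := by
    rw [integral_norm_sq_expSeries hgs]
    refine Real.tsum_le_of_sum_range_le (fun n => sq_nonneg _) fun M => ?_
    refine le_trans (sum_le_sum fun n _ => ?_)
      ((sum_range_exp_neg_pow_le hN1 M).trans (by linarith))
    rw [hg, Complex.norm_real, Real.norm_of_nonneg (by positivity), sq]
    refine mul_le_of_le_one_left (by positivity) (pow_le_one₀ (by positivity) ?_)
    rw [Real.exp_le_one_iff, neg_nonpos]
    positivity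
  have ht : 0 < √(L / y) := Real.sqrt_pos.mpr (by positivity)
  rw [← hmain, ← intervalIntegral.integral_sub
    (Continuous.intervalIntegrable (by fun_prop (disch := exact hzne _)) _ _)
    (Continuous.intervalIntegrable (by fun_prop) _ _)]
  simp only [mul_div_assoc, ← mul_sub]
  refine (norm_integral_mul_le_of_norm_le hTc hdc hgc ht fun α hα => ?_).trans ?_
  · have h := norm_sub_mul_div_sub_mul_le (S := Stilde N α)
      (norm_one_div_zOf_sub_expSeries_le hN1 hα)
    rwa [Stilde_sub_expSeries hN1] at h
  · rw [integral_norm_sq_T_neg]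
    have hs : √(y * N * Real.log N) = √(L / y) * y := by
      rw [mul_assoc, ← hL, Real.sqrt_eq_iff_mul_self_eq (by positivity) (by positivity),
        mul_mul_mul_comm, Real.mul_self_sqrt (by positivity)]
      field_simp
    have hL2 : L = √(L / y) * (√(L / y) * y) := by
      rw [← mul_assoc, Real.mul_self_sqrt (by positivity)]
      field_simp
    calc _ ≤ √(L / y) / 2 * y + 3 / (2 * √(L / y)) * (100 * (14 * L) + 12100 * L +
          121 * (2 * L)) := by gcongr; linarith
      _ = √(L / y) / 2 * y + 41226 / 2 * (L / √(L / y)) := by field_simp; ring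
      _ = √(L / y) / 2 * y + 41226 / 2 * (√(L / y) * y) := by
        rw [(div_eq_iff ht.ne').mpr (hL2.trans (mul_comm _ _))]
      _ ≤ _ := by
        rw [hs]
        have : 0 ≤ √(L / y) * y := by positivity
        linarith
end

section
/- For every sufficiently large integer N, ∑_{m=1}^{∞} Λ(m)² e^{−2m/N} = (N/2) log N + O(N), with an absolute implied constant. -/
section

open Complex Set MeasureTheory Filter Topology

/-- The function `t ↦ {t}` on `[1, ∞)`, extended by zero. -/
noncomputable def fractTail : ℝ → ℂ := (Ici (1 : ℝ)).indicator fun t ↦ ((Int.fract t : ℝ) : ℂ)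

lemma norm_fractTail_le (t : ℝ) : ‖fractTail t‖ ≤ 1 := by
  unfold fractTail
  by_cases ht : t ∈ Ici (1 : ℝ)
  · rw [indicator_of_mem ht, norm_real, Real.norm_of_nonneg (Int.fract_nonneg t)]
    exact (Int.fract_lt_one t).le
  · simp [indicator_of_notMem ht]

lemma measurable_fractTail : Measurable fractTail :=
  (measurable_ofReal.comp measurable_fract).indicator measurableSet_Ici

lemma locallyIntegrableOn_fractTail : LocallyIntegrableOn fractTail (Ioi 0) := by
  refine LocallyIntegrable.locallyIntegrableOn ?_ _
  refine (locallyIntegrable_const (1 : ℝ)).mono measurable_fractTail.aestronglyMeasurable ?_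
  exact Eventually.of_forall fun t ↦ by simpa using norm_fractTail_le t

lemma fractTail_isBigO_atTop : fractTail =O[atTop] ((· ^ (-(0 : ℝ))) : ℝ → ℝ) := by
  refine Asymptotics.IsBigO.of_bound 1 (Eventually.of_forall fun t ↦ ?_)
  simpa using norm_fractTail_le t

lemma fractTail_isBigO_zero (b : ℝ) : fractTail =O[𝓝[>] 0] ((· ^ (-b)) : ℝ → ℝ) := by
  refine Asymptotics.IsBigO.of_bound 1 ?_
  filter_upwards [mem_nhdsWithin_of_mem_nhds (Iio_mem_nhds one_pos)] with t ht
  have : fractTail t = 0 := indicator_of_notMem (by simpa using ht) _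
  rw [this]; simp

/-- The regular part `ζ(s) - 1 / (s - 1)` of the Riemann zeta function, valid for `0 < re s`. -/
noncomputable def zetaReg (s : ℂ) : ℂ := 1 - s * mellin fractTail (-s)

lemma differentiableAt_zetaReg {s : ℂ} (hs : 0 < s.re) : DifferentiableAt ℂ zetaReg s := by
  have h : DifferentiableAt ℂ (mellin fractTail) (-s) :=
    mellin_differentiableAt_of_isBigO_rpow locallyIntegrableOn_fractTail fractTail_isBigO_atTop
      (by simpa using hs) (fractTail_isBigO_zero ((-s).re - 1)) (by linarith)
  exact (differentiableAt_const _).sub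
    (differentiableAt_id.mul (h.comp s differentiableAt_id.neg))

lemma mellin_fractTail (s : ℂ) :
    mellin fractTail (-s) = ∫ t in Ioi (1 : ℝ), (t : ℂ) ^ (-s - 1) * (Int.fract t : ℝ) := by
  rw [mellin, ← integral_Ici_eq_integral_Ioi' (x := 1) (by simp),
    ← integral_indicator measurableSet_Ici, ← integral_indicator measurableSet_Ioi]
  congr 1 with t
  by_cases ht : t ∈ Ici (1 : ℝ)
  · rw [indicator_of_mem ht, indicator_of_mem (mem_Ioi.mpr (one_pos.trans_le (mem_Ici.mp ht))),
      fractTail, indicator_of_mem ht, smul_eq_mul]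
  · simp only [indicator_of_notMem ht, indicator_apply, fractTail, ht, if_false, smul_zero, ite_self]

lemma norm_mellin_fractTail_le {s : ℂ} (hs : 1 / 2 ≤ s.re) : ‖mellin fractTail (-s)‖ ≤ 2 := by
  rw [mellin_fractTail]
  have hs0 : 0 < s.re := by linarith
  calc _ ≤ ∫ t in Ioi (1 : ℝ), t ^ (-s.re - 1) := by
        refine norm_integral_le_of_norm_le (integrableOn_Ioi_rpow_of_lt (by linarith) one_pos) ?_
        filter_upwards [ae_restrict_mem measurableSet_Ioi] with t ht
        have ht0 : (0 : ℝ) < t := one_pos.trans ht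
        rw [norm_mul, norm_cpow_eq_rpow_re_of_pos ht0, norm_real,
          Real.norm_of_nonneg (Int.fract_nonneg t)]
        simpa using mul_le_of_le_one_right (by positivity) (Int.fract_lt_one t).le
    _ = 1 / s.re := by
        rw [integral_Ioi_rpow_of_lt (by linarith) one_pos]
        simp
    _ ≤ 2 := by rw [div_le_iff₀ hs0]; linarith

lemma norm_zetaReg_le {s : ℂ} (hs : 1 / 2 ≤ s.re) : ‖zetaReg s‖ ≤ 1 + 2 * ‖s‖ := by
  unfold zetaReg
  calc _ ≤ ‖(1 : ℂ)‖ + ‖s * mellin fractTail (-s)‖ := norm_sub_le _ _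
    _ ≤ _ := by
      rw [norm_one, norm_mul]
      nlinarith [norm_mellin_fractTail_le hs, norm_nonneg s]

lemma riemannZeta_eq_of_one_lt_re {s : ℂ} (hs : 1 < s.re) :
    riemannZeta s = 1 / (s - 1) + zetaReg s := by
  have hs1 : s - 1 ≠ 0 := by
    intro h
    rw [sub_eq_zero.mp h] at hs
    simp at hs
  have hO : (fun n : ℕ ↦ ∑ k ∈ Finset.Icc 1 n, ‖(1 : ℕ → ℂ) k‖) =O[atTop]
      fun n ↦ (n : ℝ) ^ (1 : ℝ) := by
    refine Asymptotics.IsBigO.of_bound 1 (Eventually.of_forall fun n ↦ ?_)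
    simp
  have hint1 : IntegrableOn (fun t : ℝ ↦ (t : ℂ) ^ (-s)) (Ioi 1) :=
    integrableOn_Ioi_cpow_of_lt (by simpa using hs) one_pos
  have hint2 : IntegrableOn (fun t : ℝ ↦ (t : ℂ) ^ (-s - 1) * (Int.fract t : ℝ)) (Ioi 1) := by
    have h := integrableOn_Ioi_cpow_of_lt (a := -s - 1) (c := 1) (by simp; linarith) one_pos
    refine Integrable.mul_bdd (c := 1) h (measurable_ofReal.comp measurable_fract).aestronglyMeasurable
      (Eventually.of_forall fun t ↦ ?_)
    rw [norm_real, Real.norm_of_nonneg (Int.fract_nonneg t)]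
    exact (Int.fract_lt_one t).le
  rw [← LSeries_one_eq_riemannZeta hs,
    LSeries_eq_mul_integral' (1 : ℕ → ℂ) zero_le_one (by exact_mod_cast hs) hO]
  have : ∫ t in Ioi (1 : ℝ), (∑ k ∈ Finset.Icc 1 ⌊t⌋₊, (1 : ℕ → ℂ) k) * (t : ℂ) ^ (-(s + 1)) =
      ∫ t in Ioi (1 : ℝ), ((t : ℂ) ^ (-s) - (t : ℂ) ^ (-s - 1) * (Int.fract t : ℝ)) := by
    refine setIntegral_congr_fun measurableSet_Ioi fun t ht ↦ ?_
    have ht0 : (0 : ℝ) < t := one_pos.trans ht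
    have htc : (t : ℂ) ≠ 0 := by exact_mod_cast ht0.ne'
    have hfl : ((⌊t⌋₊ : ℕ) : ℂ) = t - (Int.fract t : ℝ) := by
      rw [Int.fract, ← natCast_floor_eq_intCast_floor ht0.le]
      push_cast
      ring
    have hpow : (t : ℂ) ^ (-s) = t * (t : ℂ) ^ (-s - 1) := by
      rw [cpow_sub _ _ htc, cpow_one]
      field_simp
    simp only [Pi.one_apply, Finset.sum_const, Nat.card_Icc, Nat.add_sub_cancel, nsmul_eq_mul,
      mul_one]
    rw [hfl, hpow, neg_add']
    ring
  rw [this, integral_sub hint1 hint2, integral_Ioi_cpow_of_lt (by simpa using hs) one_pos, zetaReg,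
    mellin_fractTail]
  have : -s + 1 ≠ 0 := by intro h; apply hs1; linear_combination -h
  simp only [ofReal_one, one_cpow]
  generalize (∫ t in Ioi (1 : ℝ), (t : ℂ) ^ (-s - 1) * (Int.fract t : ℝ)) = J
  field_simp
  ring

/-- The function `(s - 1) * ζ(s)`, valid for `0 < re s`. -/
noncomputable def zetaMul (s : ℂ) : ℂ := 1 + (s - 1) * zetaReg s

lemma differentiableAt_zetaMul {s : ℂ} (hs : 0 < s.re) : DifferentiableAt ℂ zetaMul s :=
  (differentiableAt_const _).add
    ((differentiableAt_id.sub (differentiableAt_const _)).mul (differentiableAt_zetaReg hs))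

lemma zetaMul_eq {s : ℂ} (hs : 1 ≤ s.re) (hs1 : s ≠ 1) :
    zetaMul s = (s - 1) * riemannZeta s := by
  have h1 {z : ℂ} (hz : 1 < z.re) : zetaMul z = (z - 1) * riemannZeta z := by
    have : z - 1 ≠ 0 := by
      intro h
      rw [sub_eq_zero.mp h] at hz
      simp at hz
    rw [riemannZeta_eq_of_one_lt_re hz, zetaMul]
    field_simp
  have hl : Tendsto (fun ε : ℝ ↦ s + ε) (𝓝[>] 0) (𝓝 s) := by
    have : Tendsto (fun ε : ℝ ↦ s + ε) (𝓝 0) (𝓝 (s + (0 : ℝ))) :=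
      (continuous_const.add continuous_ofReal).tendsto _
    simpa using this.mono_left nhdsWithin_le_nhds
  have h2 : Tendsto (fun ε : ℝ ↦ zetaMul (s + ε)) (𝓝[>] 0) (𝓝 (zetaMul s)) :=
    (differentiableAt_zetaMul (by linarith)).continuousAt.tendsto.comp hl
  have h3 : Tendsto (fun ε : ℝ ↦ (s + ε - 1) * riemannZeta (s + ε)) (𝓝[>] 0)
      (𝓝 ((s - 1) * riemannZeta s)) :=
    (hl.sub_const 1).mul ((differentiableAt_riemannZeta hs1).continuousAt.tendsto.comp hl)
  refine tendsto_nhds_unique h2 (h3.congr' ?_)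
  filter_upwards [self_mem_nhdsWithin] with ε hε
  refine (h1 ?_).symm
  have : 0 < ε := hε
  simp
  linarith

lemma zetaMul_ne_zero {s : ℂ} (hs : 1 ≤ s.re) : zetaMul s ≠ 0 := by
  by_cases hs1 : s = 1
  · simp [hs1, zetaMul]
  · rw [zetaMul_eq hs hs1]
    exact mul_ne_zero (sub_ne_zero.mpr hs1) (riemannZeta_ne_zero_of_one_le_re hs)

lemma norm_deriv_le_of_polynomial_growth {f : ℂ → ℂ} {a b C : ℝ} {k : ℕ} (hC : 0 ≤ C)
    (ha : 0 < a) (hd : ∀ s : ℂ, 0 < s.re → DifferentiableAt ℂ f s)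
    (hf : ∀ s : ℂ, a ≤ s.re → s.re ≤ b → ‖f s‖ ≤ C * (2 + |s.im|) ^ k) (s : ℂ)
    (has : a + 1 / 4 ≤ s.re) (hsb : s.re ≤ b - 1 / 4) :
    ‖deriv f s‖ ≤ 4 * 2 ^ k * C * (2 + |s.im|) ^ k := by
  have key : ∀ z ∈ Metric.closedBall s (1 / 4 : ℝ), |z.re - s.re| ≤ 1 / 4 ∧ |z.im - s.im| ≤ 1 / 4 :=
    fun z hz ↦ by
      rw [Metric.mem_closedBall, dist_eq_norm] at hz
      exact ⟨by simpa using (abs_re_le_norm (z - s)).trans hz,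
        by simpa using (abs_im_le_norm (z - s)).trans hz⟩
  have h : ‖deriv f s‖ ≤ C * (2 * (2 + |s.im|)) ^ k / (1 / 4) := by
    refine norm_deriv_le_of_forall_mem_sphere_norm_le (by norm_num) ?_ fun z hz ↦ ?_
    · refine DifferentiableOn.diffContOnCl fun z hz ↦ ?_
      have hz := (key z (Metric.closure_ball_subset_closedBall hz)).1
      refine (hd z ?_).differentiableWithinAt
      linarith [(abs_le.mp hz).1]
    · obtain ⟨h1, h2⟩ := key z (Metric.sphere_subset_closedBall hz)
      refine (hf z (by linarith [(abs_le.mp h1).1]) (by linarith [(abs_le.mp h1).2])).trans ?_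
      gcongr
      have := abs_sub_abs_le_abs_sub z.im s.im
      linarith [abs_nonneg s.im]
  calc _ ≤ _ := h
    _ = _ := by rw [mul_pow]; ring

lemma differentiableAt_deriv_of_half_plane {f : ℂ → ℂ}
    (hd : ∀ s : ℂ, 0 < s.re → DifferentiableAt ℂ f s) (s : ℂ) (hs : 0 < s.re) :
    DifferentiableAt ℂ (deriv f) s := by
  have ho : IsOpen {z : ℂ | 0 < z.re} := isOpen_lt continuous_const continuous_re
  have h1 : DifferentiableOn ℂ f {z : ℂ | 0 < z.re} :=
    fun z hz ↦ (hd z hz).differentiableWithinAt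
  exact (h1.deriv ho).differentiableAt (ho.mem_nhds hs)

lemma norm_zetaReg_le_of_strip (s : ℂ) (h1 : 1 / 2 ≤ s.re) (h2 : s.re ≤ 3) :
    ‖zetaReg s‖ ≤ 4 * (2 + |s.im|) ^ 1 := by
  have := norm_zetaReg_le h1
  have h3 := norm_le_abs_re_add_abs_im s
  rw [abs_of_nonneg (by linarith : 0 ≤ s.re)] at h3
  linarith [abs_nonneg s.im]

lemma norm_zetaMul_le_of_strip (s : ℂ) (h1 : 1 / 2 ≤ s.re) (h2 : s.re ≤ 3) :
    ‖zetaMul s‖ ≤ 9 * (2 + |s.im|) ^ 2 := by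
  have h3 := norm_zetaReg_le_of_strip s h1 h2
  have h4 : ‖s - 1‖ ≤ 2 + |s.im| := by
    refine (norm_le_abs_re_add_abs_im _).trans ?_
    have : |s.re - 1| ≤ 2 := abs_le.mpr ⟨by linarith, by linarith⟩
    simpa using this
  have h0 := abs_nonneg s.im
  calc ‖zetaMul s‖ ≤ ‖(1 : ℂ)‖ + ‖(s - 1) * zetaReg s‖ := norm_add_le _ _
    _ ≤ 1 + (2 + |s.im|) * (4 * (2 + |s.im|) ^ 1) := by
        rw [norm_one, norm_mul]
        gcongr
    _ ≤ _ := by nlinarith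

lemma exists_zetaMul_bounds : ∃ K : ℝ, 1 ≤ K ∧ ∀ s : ℂ, 1 ≤ s.re → s.re ≤ 2 →
    ‖deriv zetaReg s‖ ≤ K * (2 + |s.im|) ^ 2 ∧ ‖zetaMul s‖ ≤ K * (2 + |s.im|) ^ 2 ∧
    ‖deriv zetaMul s‖ ≤ K * (2 + |s.im|) ^ 2 ∧
    ‖deriv (deriv zetaMul) s‖ ≤ K * (2 + |s.im|) ^ 2 := by
  have hR := norm_deriv_le_of_polynomial_growth (by norm_num) (by norm_num)
    (fun s ↦ differentiableAt_zetaReg) norm_zetaReg_le_of_strip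
  have hM := norm_deriv_le_of_polynomial_growth (by norm_num) (by norm_num)
    (fun s ↦ differentiableAt_zetaMul) norm_zetaMul_le_of_strip
  have hM' := norm_deriv_le_of_polynomial_growth (by norm_num) (by norm_num)
    (differentiableAt_deriv_of_half_plane fun s ↦ differentiableAt_zetaMul) hM
  refine ⟨10000, by norm_num, fun s h1 h2 ↦ ⟨?_, ?_, ?_, ?_⟩⟩
  · refine (hR s (by linarith) (by linarith)).trans ?_
    nlinarith [abs_nonneg s.im]
  · refine (norm_zetaMul_le_of_strip s (by linarith) (by linarith)).trans ?_
    gcongr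
    norm_num
  · refine (hM s (by linarith) (by linarith)).trans ?_
    gcongr
    norm_num
  · refine (hM' s (by linarith) (by linarith)).trans ?_
    gcongr
    norm_num

lemma one_le_norm_riemannZeta_product {x : ℝ} (hx : 0 < x) (t : ℝ) :
    1 ≤ ‖riemannZeta (1 + x)‖ ^ 3 * ‖riemannZeta (1 + x + I * t)‖ ^ 4 *
      ‖riemannZeta (1 + x + 2 * I * t)‖ := by
  have h := DirichletCharacter.norm_LSeries_product_ge_one (N := 1) 1 hx t
  have h1 : LSeries (fun n ↦ (1 : DirichletCharacter ℂ 1) n) = LSeries 1 := by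
    rw [DirichletCharacter.modOne_eq_one]
  rw [one_pow, h1] at h
  rwa [LSeries_one_eq_riemannZeta (by simpa using hx),
    LSeries_one_eq_riemannZeta (by simpa using hx), LSeries_one_eq_riemannZeta (by simpa using hx),
    norm_mul, norm_mul, norm_pow, norm_pow] at h

lemma rpow_three_le_of_zetaMul_bound {K : ℝ} (hK : 1 ≤ K)
    (hb : ∀ s : ℂ, 1 ≤ s.re → s.re ≤ 2 → ‖zetaMul s‖ ≤ K * (2 + |s.im|) ^ 2)
    {x t : ℝ} (hx : 0 < x) (hx1 : x ≤ 1) (ht : 1 ≤ |t|) :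
    x ^ 3 ≤ (4 * K * (2 + |t|) * ‖zetaMul (1 + x + I * t)‖) ^ 4 := by
  have h := one_le_norm_riemannZeta_product hx t
  have e1 : zetaMul (1 + x) = x * riemannZeta (1 + x) := by
    rw [zetaMul_eq (by simpa using hx.le) (by simpa using hx.ne')]
    ring
  have e2 : zetaMul (1 + x + I * t) = (x + I * t) * riemannZeta (1 + x + I * t) := by
    rw [zetaMul_eq (by simpa using hx.le)]
    · ring
    · intro h0
      have := congrArg re h0
      simp at this
      exact hx.ne' this
  have e3 : zetaMul (1 + x + 2 * I * t) = (x + 2 * I * t) * riemannZeta (1 + x + 2 * I * t) := by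
    rw [zetaMul_eq (by simpa using hx.le)]
    · ring
    · intro h0
      have := congrArg re h0
      simp at this
      exact hx.ne' this
  have n1 : x * ‖riemannZeta (1 + x)‖ ≤ 4 * K := by
    have := hb (1 + x) (by simpa using hx.le) (by simp; linarith)
    rw [e1, norm_mul, norm_real, Real.norm_of_nonneg hx.le] at this
    simp at this
    linarith
  have n2 : ‖riemannZeta (1 + x + I * t)‖ ≤ ‖zetaMul (1 + x + I * t)‖ := by
    rw [e2, norm_mul]
    refine le_mul_of_one_le_left (norm_nonneg _) (ht.trans ?_)
    simpa using abs_im_le_norm (x + I * t)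
  have n3 : ‖riemannZeta (1 + x + 2 * I * t)‖ ≤ 4 * K * (2 + |t|) ^ 2 := by
    have h1 : ‖riemannZeta (1 + x + 2 * I * t)‖ ≤ ‖zetaMul (1 + x + 2 * I * t)‖ := by
      rw [e3, norm_mul]
      refine le_mul_of_one_le_left (norm_nonneg _) ?_
      have := abs_im_le_norm (x + 2 * I * t)
      simp [abs_mul] at this
      linarith
    refine h1.trans ((hb _ (by simpa using hx.le) (by simp; linarith)).trans ?_)
    have : |(1 + x + 2 * I * t : ℂ).im| = 2 * |t| := by simp [abs_mul]
    rw [this]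
    have : (2 + 2 * |t|) ^ 2 ≤ 4 * (2 + |t|) ^ 2 := by nlinarith
    nlinarith
  set A := ‖riemannZeta (1 + x)‖
  set B := ‖riemannZeta (1 + x + I * t)‖
  set Z := ‖zetaMul (1 + x + I * t)‖
  set E := ‖riemannZeta (1 + x + 2 * I * t)‖
  have hw : 1 ≤ (2 + |t|) ^ 2 := one_le_pow₀ (by linarith)
  calc x ^ 3 = x ^ 3 * 1 := by ring
    _ ≤ x ^ 3 * (A ^ 3 * B ^ 4 * E) := by gcongr
    _ = (x * A) ^ 3 * B ^ 4 * E := by ring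
    _ ≤ (4 * K) ^ 3 * Z ^ 4 * (4 * K * (2 + |t|) ^ 2) := by gcongr
    _ = (4 * K) ^ 4 * Z ^ 4 * ((2 + |t|) ^ 2 * 1) := by ring
    _ ≤ (4 * K) ^ 4 * Z ^ 4 * ((2 + |t|) ^ 2 * (2 + |t|) ^ 2) := by gcongr
    _ = _ := by ring

lemma exists_zetaMul_lower_bound : ∃ c : ℝ, 0 < c ∧ ∀ s : ℂ, 1 < s.re → s.re ≤ 2 →
    c ≤ ‖zetaMul s‖ * (2 + |s.im|) ^ 10 := by
  obtain ⟨K, hK, hb⟩ := exists_zetaMul_bounds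
  have hcomp : IsCompact (Icc (1 : ℝ) 2 ×ℂ Icc (-1 : ℝ) 1) :=
    isCompact_Icc.reProdIm isCompact_Icc
  have hne : (Icc (1 : ℝ) 2 ×ℂ Icc (-1 : ℝ) 1).Nonempty := ⟨1, by simp [mem_reProdIm]⟩
  obtain ⟨z₀, hz₀, hmin⟩ := hcomp.exists_isMinOn (f := fun s ↦ ‖zetaMul s‖) hne fun s hs ↦
    (differentiableAt_zetaMul (by
      have := (mem_reProdIm.mp hs).1.1
      linarith)).continuousAt.norm.continuousWithinAt
  have hm : 0 < ‖zetaMul z₀‖ := norm_pos_iff.mpr (zetaMul_ne_zero (mem_reProdIm.mp hz₀).1.1)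
  refine ⟨min ‖zetaMul z₀‖ (1 / (4096 * K ^ 7)), by positivity, fun s h1 h2 ↦ ?_⟩
  have hw : 1 ≤ (2 + |s.im|) ^ 10 := one_le_pow₀ (by linarith [abs_nonneg s.im])
  by_cases ht : |s.im| ≤ 1
  · refine (min_le_left _ _).trans ?_
    have : ‖zetaMul z₀‖ ≤ ‖zetaMul s‖ := hmin (mem_reProdIm.mpr ⟨⟨h1.le, h2⟩, abs_le.mp ht⟩)
    exact this.trans (le_mul_of_one_le_right (norm_nonneg _) hw)
  refine (min_le_right _ _).trans ?_
  replace ht : 1 ≤ |s.im| := (not_le.mp ht).le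
  obtain ⟨x, hx, hx1, t, rfl⟩ : ∃ x : ℝ, 0 < x ∧ x ≤ 1 ∧ ∃ t : ℝ, s = 1 + x + I * t := by
    refine ⟨s.re - 1, by linarith, by linarith, s.im, ?_⟩
    apply Complex.ext <;> simp
  have him (x : ℝ) : (1 + x + I * t : ℂ).im = t := by simp
  rw [him] at ht hw ⊢
  set w := 2 + |t|
  have hw1 : 1 ≤ w := by linarith
  set y : ℝ := 1 / (8 * K ^ 2 * w ^ 3)
  have hy0 : 0 < y := by positivity
  have hy1 : y ≤ 1 := by
    rw [div_le_one (by positivity)]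
    nlinarith [one_le_pow₀ (n := 3) hw1, one_le_pow₀ (n := 2) hK]
  have hyw : 8 * K ^ 2 * w ^ 3 * y = 1 := mul_one_div_cancel (by positivity)
  have hlow {x : ℝ} (hx1 : x ≤ 1) (hyx : y ^ 4 ≤ x) :
      y ^ 3 ≤ 4 * K * w * ‖zetaMul (1 + x + I * t)‖ := by
    have h := rpow_three_le_of_zetaMul_bound hK (fun s h h' ↦ (hb s h h').2.1)
      ((pow_pos hy0 4).trans_le hyx) hx1 ht
    refine le_of_pow_le_pow_left₀ (n := 4) (by norm_num) (by positivity) (le_trans ?_ h)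
    calc (y ^ 3) ^ 4 = (y ^ 4) ^ 3 := by ring
      _ ≤ x ^ 3 := by gcongr
  have hfin : y ^ 3 / 2 ≤ 4 * K * w * ‖zetaMul (1 + x + I * t)‖ := by
    rcases le_total (y ^ 4) x with hyx | hyx
    · exact (by linarith [pow_pos hy0 3] : y ^ 3 / 2 ≤ y ^ 3).trans (hlow hx1 hyx)
    · have h0 := hlow (pow_le_one₀ hy0.le hy1) le_rfl
      have hmv : ‖zetaMul (1 + (y ^ 4 : ℝ) + I * t) - zetaMul (1 + x + I * t)‖ ≤
          K * w ^ 2 * ‖(1 + (y ^ 4 : ℝ) + I * t : ℂ) - (1 + x + I * t)‖ := by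
        have hconv : Convex ℝ (Icc (1 : ℝ) 2 ×ℂ ({t} : Set ℝ)) :=
          ((convex_Icc _ _).linear_preimage reLm).inter
            ((convex_singleton _).linear_preimage imLm)
        refine hconv.norm_image_sub_le_of_norm_deriv_le (fun z hz ↦ ?_) (fun z hz ↦ ?_) ?_ ?_
        · have := (mem_reProdIm.mp hz).1.1
          exact differentiableAt_zetaMul (by linarith)
        · obtain ⟨⟨h3, h4⟩, h5⟩ := mem_reProdIm.mp hz
          have := (hb z h3 h4).2.2.1
          rwa [h5] at this
        · rw [mem_reProdIm]
          simp
          exact ⟨hx.le, by linarith⟩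
        · rw [mem_reProdIm, him]
          have := pow_le_one₀ hy0.le hy1 (n := 4)
          refine ⟨⟨?_, ?_⟩, rfl⟩ <;> simp only [add_re, one_re, ofReal_re, mul_re, I_re, I_im,
            ofReal_im, zero_mul, mul_zero, sub_zero, add_zero]
          · linarith [pow_pos hy0 4]
          · linarith
      have hd : ‖(1 + (y ^ 4 : ℝ) + I * t : ℂ) - (1 + x + I * t)‖ ≤ y ^ 4 := by
        have : (1 + (y ^ 4 : ℝ) + I * t : ℂ) - (1 + x + I * t) = ((y ^ 4 - x : ℝ) : ℂ) := by
          push_cast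
          ring
        rw [this, norm_real, Real.norm_of_nonneg (by linarith)]
        linarith
      have h3 : ‖zetaMul (1 + (y ^ 4 : ℝ) + I * t)‖ ≤
          ‖zetaMul (1 + x + I * t)‖ + K * w ^ 2 * y ^ 4 := by
        have := norm_le_norm_add_norm_sub (zetaMul (1 + x + I * t))
          (zetaMul (1 + (y ^ 4 : ℝ) + I * t))
        have h4 : K * w ^ 2 * ‖(1 + (y ^ 4 : ℝ) + I * t : ℂ) - (1 + x + I * t)‖ ≤
          K * w ^ 2 * y ^ 4 := by gcongr
        rw [norm_sub_rev] at hmv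
        linarith
      have h4 : 4 * K * w * ‖zetaMul (1 + (y ^ 4 : ℝ) + I * t)‖ ≤
          4 * K * w * (‖zetaMul (1 + x + I * t)‖ + K * w ^ 2 * y ^ 4) := by gcongr
      have h5 : 4 * K * w * (K * w ^ 2 * y ^ 4) = y ^ 3 / 2 := by
        calc _ = (8 * K ^ 2 * w ^ 3 * y) * y ^ 3 / 2 := by ring
          _ = _ := by rw [hyw, one_mul]
      linarith
  have hy3 : (8 * K ^ 2 * w ^ 3) ^ 3 * y ^ 3 = 1 := by rw [← mul_pow, hyw, one_pow]
  rw [div_le_iff₀ (by positivity)]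
  calc (1 : ℝ) = 2 * (8 * K ^ 2 * w ^ 3) ^ 3 * (y ^ 3 / 2) := by linarith
    _ ≤ 2 * (8 * K ^ 2 * w ^ 3) ^ 3 * (4 * K * w * ‖zetaMul (1 + x + I * t)‖) := by gcongr
    _ = _ := by ring

/-- The coefficients `log n * (Λ n - 1)` of the Dirichlet series `(ζ' / ζ)' + ζ'`. -/
noncomputable def logVonMangoldtSubOne : ℕ → ℂ :=
  LSeries.logMul ((fun n ↦ (ArithmeticFunction.vonMangoldt n : ℂ)) - 1)

lemma LSeries_vonMangoldt_sub_one {s : ℂ} (hs : 1 < s.re) :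
    LSeries ((fun n ↦ (ArithmeticFunction.vonMangoldt n : ℂ)) - 1) s =
      -(deriv zetaMul s / zetaMul s) - zetaReg s := by
  have hs1 : s - 1 ≠ 0 := by
    intro h
    rw [sub_eq_zero.mp h] at hs
    simp at hs
  have hZ := zetaMul_ne_zero hs.le
  have hev : riemannZeta =ᶠ[𝓝 s] fun z ↦ zetaMul z / (z - 1) := by
    have ho : IsOpen {z : ℂ | 1 < z.re} := isOpen_lt continuous_const continuous_re
    filter_upwards [ho.mem_nhds hs] with z hz
    have hz1 : z ≠ 1 := by
      rintro rfl
      simp at hz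
    rw [zetaMul_eq (le_of_lt hz) hz1, mul_div_cancel_left₀ _ (sub_ne_zero.mpr hz1)]
  have hd : deriv riemannZeta s =
      (deriv zetaMul s * (s - 1) - zetaMul s * 1) / (s - 1) ^ 2 := by
    rw [hev.deriv_eq]
    exact ((differentiableAt_zetaMul (by linarith)).hasDerivAt.div
      ((hasDerivAt_id s).sub_const 1) hs1).deriv
  rw [LSeries_sub (ArithmeticFunction.LSeriesSummable_vonMangoldt hs)
      (LSeriesSummable_one_iff.mpr hs),
    ArithmeticFunction.LSeries_vonMangoldt_eq_deriv_riemannZeta_div hs,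
    LSeries_one_eq_riemannZeta hs, hd]
  nth_rw 2 [riemannZeta_eq_of_one_lt_re hs]
  rw [hev.eq_of_nhds]
  field_simp
  ring

lemma abscissaOfAbsConv_vonMangoldt_sub_one_lt {s : ℂ} (hs : 1 < s.re) :
    LSeries.abscissaOfAbsConv ((fun n ↦ (ArithmeticFunction.vonMangoldt n : ℂ)) - 1) < s.re := by
  refine lt_of_le_of_lt (b := ((1 : ℝ) : EReal))
    (LSeries.abscissaOfAbsConv_le_of_forall_lt_LSeriesSummable fun y hy ↦ ?_)
    (by exact_mod_cast hs)
  have hy' : 1 < (y : ℂ).re := by simpa using hy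
  exact (ArithmeticFunction.LSeriesSummable_vonMangoldt hy').sub
    (LSeriesSummable_one_iff.mpr hy')

lemma LSeriesSummable_logVonMangoldtSubOne {s : ℂ} (hs : 1 < s.re) :
    LSeriesSummable logVonMangoldtSubOne s :=
  LSeriesSummable_logMul_of_lt_re (abscissaOfAbsConv_vonMangoldt_sub_one_lt hs)

lemma LSeries_logVonMangoldtSubOne {s : ℂ} (hs : 1 < s.re) :
    LSeries logVonMangoldtSubOne s =
      (deriv (deriv zetaMul) s * zetaMul s - deriv zetaMul s * deriv zetaMul s) / zetaMul s ^ 2 +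
        deriv zetaReg s := by
  have h1 := LSeries_hasDerivAt (abscissaOfAbsConv_vonMangoldt_sub_one_lt hs)
  have hs0 : 0 < s.re := by linarith
  have h2 := (((differentiableAt_deriv_of_half_plane
    (fun s ↦ differentiableAt_zetaMul) s hs0).hasDerivAt.div
      (differentiableAt_zetaMul hs0).hasDerivAt (zetaMul_ne_zero hs.le)).neg).sub
        (differentiableAt_zetaReg hs0).hasDerivAt
  have ho : IsOpen {z : ℂ | 1 < z.re} := isOpen_lt continuous_const continuous_re
  have h3 := h2.congr_of_eventuallyEq
    ((eventually_of_mem (ho.mem_nhds hs) fun z hz ↦ LSeries_vonMangoldt_sub_one hz))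
  have := h1.unique h3
  rw [logVonMangoldtSubOne]
  linear_combination -this

lemma exists_LSeries_logVonMangoldtSubOne_bound : ∃ C : ℝ, 0 < C ∧ ∀ s : ℂ, 1 < s.re → s.re ≤ 2 →
    ‖LSeries logVonMangoldtSubOne s‖ ≤ C * (2 + |s.im|) ^ 24 := by
  obtain ⟨K, hK, hb⟩ := exists_zetaMul_bounds
  obtain ⟨c, hc, hlow⟩ := exists_zetaMul_lower_bound
  refine ⟨2 * K ^ 2 / c ^ 2 + K, by positivity, fun s h1 h2 ↦ ?_⟩
  obtain ⟨b1, b2, b3, b4⟩ := hb s h1.le h2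
  have hl := hlow s h1 h2
  have hZ : 0 < ‖zetaMul s‖ := norm_pos_iff.mpr (zetaMul_ne_zero h1.le)
  rw [LSeries_logVonMangoldtSubOne h1]
  set w := 2 + |s.im|
  have hw : 1 ≤ w := by linarith [abs_nonneg s.im]
  have e1 : ‖deriv (deriv zetaMul) s * zetaMul s - deriv zetaMul s * deriv zetaMul s‖ ≤
      2 * K ^ 2 * w ^ 4 := by
    calc _ ≤ ‖deriv (deriv zetaMul) s * zetaMul s‖ + ‖deriv zetaMul s * deriv zetaMul s‖ :=
          norm_sub_le _ _
      _ ≤ (K * w ^ 2) * (K * w ^ 2) + (K * w ^ 2) * (K * w ^ 2) := by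
          rw [norm_mul, norm_mul]
          gcongr
      _ = _ := by ring
  calc _ ≤ ‖deriv (deriv zetaMul) s * zetaMul s - deriv zetaMul s * deriv zetaMul s‖ /
        ‖zetaMul s‖ ^ 2 + ‖deriv zetaReg s‖ := by
        refine (norm_add_le _ _).trans ?_
        rw [norm_div, norm_pow]
    _ ≤ 2 * K ^ 2 / c ^ 2 * w ^ 24 + K * w ^ 24 := by
        refine add_le_add ?_ (b1.trans ?_)
        · rw [div_le_iff₀ (by positivity)]
          refine e1.trans ?_
          have : c ^ 2 ≤ (‖zetaMul s‖ * w ^ 10) ^ 2 := by gcongr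
          calc 2 * K ^ 2 * w ^ 4 = 2 * K ^ 2 / c ^ 2 * w ^ 4 * c ^ 2 := by field_simp
            _ ≤ 2 * K ^ 2 / c ^ 2 * w ^ 4 * (‖zetaMul s‖ * w ^ 10) ^ 2 := by gcongr
            _ = _ := by ring
        · gcongr
          norm_num
    _ = _ := by ring

lemma norm_Gamma_le_Gamma_re {s : ℂ} (hs : 0 < s.re) : ‖Gamma s‖ ≤ Real.Gamma s.re := by
  rw [Gamma_eq_integral hs, GammaIntegral, Real.Gamma_eq_integral hs]
  refine norm_integral_le_of_norm_le (Real.GammaIntegral_convergent hs) ?_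
  filter_upwards [ae_restrict_mem measurableSet_Ioi] with t ht
  rw [norm_mul, norm_cpow_eq_rpow_re_of_pos ht, norm_real,
    Real.norm_of_nonneg (Real.exp_pos _).le]
  simp

lemma norm_Gamma_mul_pow_le {s : ℂ} (hs : 0 < s.re) (n : ℕ) :
    ‖Gamma s‖ * ‖s‖ ^ n ≤ Real.Gamma (s.re + n) := by
  suffices ‖Gamma s‖ * ‖s‖ ^ n ≤ ‖Gamma (s + n)‖ from
    this.trans (by simpa using norm_Gamma_le_Gamma_re (s := s + n) (by simp; positivity))
  induction n with
  | zero => simp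
  | succ n ih =>
    have hsn : s + n ≠ 0 := by
      intro h
      have := congrArg re h
      simp at this
      have : (0 : ℝ) ≤ n := n.cast_nonneg
      linarith
    have hle : ‖s‖ ≤ ‖s + n‖ := by
      rw [← sq_le_sq₀ (norm_nonneg _) (norm_nonneg _), ← normSq_eq_norm_sq, ← normSq_eq_norm_sq,
        normSq_apply, normSq_apply]
      simp
      have : (0 : ℝ) ≤ n := n.cast_nonneg
      nlinarith
    rw [Nat.cast_succ, ← add_assoc, Gamma_add_one _ hsn, norm_mul, pow_succ, ← mul_assoc,
      mul_comm ‖s + n‖]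
    gcongr

lemma exists_norm_Gamma_decay (n : ℕ) : ∃ C : ℝ, 0 < C ∧ ∀ s : ℂ, 1 ≤ s.re → s.re ≤ 2 →
    ‖Gamma s‖ * (2 + |s.im|) ^ n ≤ C := by
  refine ⟨3 ^ n * max 1 (Real.Gamma (2 + n)), by positivity, fun s h1 h2 ↦ ?_⟩
  have hg : Real.Gamma (s.re + n) ≤ max 1 (Real.Gamma (2 + n)) := by
    rcases n.eq_zero_or_pos with rfl | hn
    · refine le_max_of_le_left ?_
      have := Real.convexOn_Gamma.le_max_of_mem_Icc (x := 1) (y := 2) (z := s.re) (by simp)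
        (by simp) ⟨h1, h2⟩
      simpa using this
    · refine le_max_of_le_right ?_
      have hn1 : (1 : ℝ) ≤ n := by exact_mod_cast hn
      exact Real.Gamma_strictMonoOn_Ici.monotoneOn (mem_Ici.mpr (by linarith))
        (mem_Ici.mpr (by linarith)) (by linarith)
  have hle : 2 + |s.im| ≤ 3 * ‖s‖ := by
    have h3 := abs_im_le_norm s
    have h4 := (le_abs_self _).trans (abs_re_le_norm s)
    linarith
  calc ‖Gamma s‖ * (2 + |s.im|) ^ n ≤ ‖Gamma s‖ * (3 * ‖s‖) ^ n := by gcongr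
    _ = 3 ^ n * (‖Gamma s‖ * ‖s‖ ^ n) := by rw [mul_pow]; ring
    _ ≤ _ := by
      gcongr
      exact (norm_Gamma_mul_pow_le (by linarith) n).trans hg

lemma continuous_Gamma_vertical {σ : ℝ} (hσ : 0 < σ) :
    Continuous fun t : ℝ ↦ Gamma (σ + t * I) := by
  refine continuous_iff_continuousAt.mpr fun t ↦ ?_
  have h : ContinuousAt Gamma (σ + t * I) := by
    refine (differentiableAt_Gamma _ fun m hm ↦ ?_).continuousAt
    have := congrArg re hm
    simp at this
    have h0 : (0 : ℝ) ≤ m := m.cast_nonneg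
    linarith
  exact ContinuousAt.comp (f := fun t : ℝ ↦ (σ + t * I : ℂ)) h (by fun_prop)

lemma exists_norm_Gamma_vertical_le : ∃ C : ℝ, 0 < C ∧ ∀ σ : ℝ, 1 ≤ σ → σ ≤ 2 → ∀ t : ℝ,
    ‖Gamma (σ + t * I)‖ * (2 + |t|) ^ 24 ≤ C * (1 + t ^ 2)⁻¹ := by
  obtain ⟨C, hC, h⟩ := exists_norm_Gamma_decay 26
  refine ⟨C, hC, fun σ h1 h2 t ↦ ?_⟩
  have := h (σ + t * I) (by simpa using h1) (by simpa using h2)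
  simp only [add_im, ofReal_im, mul_im, ofReal_re, I_im, mul_one, I_re, mul_zero, add_zero,
    zero_add] at this
  rw [← div_eq_mul_inv, le_div_iff₀ (by positivity)]
  refine le_trans ?_ this
  have h3 : 1 + t ^ 2 ≤ (2 + |t|) ^ 2 := by
    rw [← sq_abs t]
    nlinarith [abs_nonneg t]
  calc _ ≤ ‖Gamma (σ + t * I)‖ * (2 + |t|) ^ 24 * (2 + |t|) ^ 2 := by gcongr
    _ = _ := by ring

lemma integrable_Gamma_vertical {σ : ℝ} (h1 : 1 ≤ σ) (h2 : σ ≤ 2) :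
    Integrable fun t : ℝ ↦ Gamma (σ + t * I) := by
  obtain ⟨C, hC, h⟩ := exists_norm_Gamma_vertical_le
  refine (integrable_inv_one_add_sq.const_mul C).mono'
    (continuous_Gamma_vertical (by linarith)).aestronglyMeasurable
    (Eventually.of_forall fun t ↦ le_trans ?_ (h σ h1 h2 t))
  exact le_mul_of_one_le_right (norm_nonneg _) (one_le_pow₀ (by linarith [abs_nonneg t]))

lemma integral_cpow_mul_Gamma {σ : ℝ} (h1 : 1 ≤ σ) (h2 : σ ≤ 2) {y : ℝ} (hy : 0 < y) :
    ∫ t : ℝ, (y : ℂ) ^ (-(σ + t * I)) * Gamma (σ + t * I) = 2 * Real.pi * Real.exp (-y) := by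
  have hmel {t : ℝ} : mellin (fun x ↦ ((Real.exp (-x) : ℝ) : ℂ)) (σ + t * I) =
      Gamma (σ + t * I) := by
    rw [← GammaIntegral_eq_mellin, Gamma_eq_integral]
    simpa using (by linarith : 0 < σ)
  have hconv : MellinConvergent (fun x ↦ ((Real.exp (-x) : ℝ) : ℂ)) σ := by
    have := GammaIntegral_convergent (s := σ) (by simpa using (by linarith : 0 < σ))
    simpa only [MellinConvergent, smul_eq_mul, mul_comm] using this
  have h := mellinInv_mellin_eq σ (fun x ↦ ((Real.exp (-x) : ℝ) : ℂ)) hy hconv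
    (by
      rw [VerticalIntegrable]
      simp_rw [hmel]
      exact integrable_Gamma_vertical h1 h2)
    (by fun_prop)
  rw [mellinInv] at h
  simp_rw [hmel, smul_eq_mul] at h
  rw [← h, real_smul]
  generalize ∫ t : ℝ, (y : ℂ) ^ (-(σ + t * I)) * Gamma (σ + t * I) = J
  push_cast
  field_simp

lemma logVonMangoldtSubOne_zero : logVonMangoldtSubOne 0 = 0 := by
  simp [logVonMangoldtSubOne, LSeries.logMul]

lemma term_mul_cpow (a : ℕ → ℂ) (s : ℂ) {δ : ℝ} (hδ : 0 < δ) {n : ℕ} (hn : n ≠ 0) :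
    LSeries.term a s n * (δ : ℂ) ^ (-s) = a n * ((n * δ : ℝ) : ℂ) ^ (-s) := by
  rw [LSeries.term_of_ne_zero hn, ofReal_mul, mul_cpow_ofReal_nonneg n.cast_nonneg hδ.le,
    ofReal_natCast, cpow_neg (n : ℂ)]
  ring

lemma exists_norm_tsum_logVonMangoldtSubOne_le_rpow : ∃ C : ℝ, 0 < C ∧ ∀ δ : ℝ, 0 < δ →
    ∀ σ : ℝ, 1 < σ → σ ≤ 2 →
      ‖∑' n : ℕ, logVonMangoldtSubOne n * Real.exp (-(n * δ))‖ ≤ C * δ ^ (-σ) := by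
  obtain ⟨A, hA, hL⟩ := exists_LSeries_logVonMangoldtSubOne_bound
  obtain ⟨B, hB, hG⟩ := exists_norm_Gamma_vertical_le
  refine ⟨A * B, by positivity, fun δ hδ σ h1 h2 ↦ ?_⟩
  set a := logVonMangoldtSubOne
  have hδc (t : ℝ) : ‖(δ : ℂ) ^ (-(σ + t * I))‖ = δ ^ (-σ) := by
    rw [norm_cpow_eq_rpow_re_of_pos hδ]
    simp
  have hterm (n : ℕ) (t : ℝ) : ‖LSeries.term a (σ + t * I) n‖ = ‖LSeries.term a σ n‖ := by
    rw [LSeries.norm_term_eq, LSeries.norm_term_eq]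
    simp
  let F : ℕ → ℝ → ℂ := fun n t ↦
    LSeries.term a (σ + t * I) n * (δ : ℂ) ^ (-(σ + t * I)) * Gamma (σ + t * I)
  have hFn (n : ℕ) (t : ℝ) :
      ‖F n t‖ = ‖LSeries.term a σ n‖ * (δ ^ (-σ) * ‖Gamma (σ + t * I)‖) := by
    simp only [F, norm_mul, hδc, hterm, mul_assoc]
  have hΓ := integrable_Gamma_vertical h1.le h2
  have hδ0 : (δ : ℂ) ≠ 0 := by exact_mod_cast hδ.ne'
  have hFcont (n : ℕ) : Continuous (F n) := by
    refine Continuous.mul (Continuous.mul ?_ ?_) (continuous_Gamma_vertical (by linarith))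
    · rcases eq_or_ne n 0 with rfl | hn
      · simpa using continuous_const
      · simp only [LSeries.term_of_ne_zero hn]
        have hn0 : (n : ℂ) ≠ 0 := by exact_mod_cast hn
        refine continuous_const.div ?_ fun t ↦ by simp [cpow_eq_zero_iff, hn0]
        exact Continuous.const_cpow (by fun_prop) (Or.inl hn0)
    · exact Continuous.const_cpow (by fun_prop) (Or.inl hδ0)
  have hFint (n : ℕ) : Integrable (F n) := by
    refine ((hΓ.norm.const_mul (δ ^ (-σ))).const_mul ‖LSeries.term a σ n‖).mono'
      (hFcont n).aestronglyMeasurable (Eventually.of_forall fun t ↦ (hFn n t).le)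
  have hFsum : Summable fun n ↦ ∫ t, ‖F n t‖ := by
    simp_rw [hFn, integral_const_mul]
    refine Summable.mul_right _ ?_
    exact (LSeriesSummable_logVonMangoldtSubOne (s := σ) (by simpa using h1)).norm
  have hsum := hasSum_integral_of_summable_integral_norm hFint hFsum
  have hval (n : ℕ) : ∫ t, F n t = 2 * Real.pi * (a n * Real.exp (-(n * δ))) := by
    rcases eq_or_ne n 0 with rfl | hn
    · simp [F, a, logVonMangoldtSubOne_zero]
    · have hn0 : (0 : ℝ) < n := by exact_mod_cast Nat.pos_of_ne_zero hn
      simp only [F, term_mul_cpow a _ hδ hn]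
      simp_rw [mul_assoc (a n)]
      rw [integral_const_mul, integral_cpow_mul_Gamma h1.le h2 (by positivity)]
      ring
  simp_rw [hval] at hsum
  have hnorm : ‖∫ t, ∑' n, F n t‖ ≤ A * B * δ ^ (-σ) * Real.pi := by
    rw [← integral_univ_inv_one_add_sq, ← integral_const_mul]
    refine norm_integral_le_of_norm_le (integrable_inv_one_add_sq.const_mul _)
      (Eventually.of_forall fun t ↦ ?_)
    simp only [F]
    rw [tsum_mul_right, tsum_mul_right, norm_mul, norm_mul, hδc]
    have hLt := hL (σ + t * I) (by simpa using h1) (by simpa using h2)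
    simp only [add_im, ofReal_im, mul_im, ofReal_re, I_im, mul_one, I_re, mul_zero, add_zero,
      zero_add] at hLt
    calc _ ≤ A * (2 + |t|) ^ 24 * δ ^ (-σ) * ‖Gamma (σ + t * I)‖ := by
          gcongr
          exact hLt
      _ = A * δ ^ (-σ) * (‖Gamma (σ + t * I)‖ * (2 + |t|) ^ 24) := by ring
      _ ≤ A * δ ^ (-σ) * (B * (1 + t ^ 2)⁻¹) := by
          exact mul_le_mul_of_nonneg_left (hG σ h1.le h2 t) (by positivity)
      _ = _ := by ring
  have htsum := hsum.tsum_eq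
  rw [tsum_mul_left] at htsum
  rw [← htsum, norm_mul] at hnorm
  have h2pi : ‖(2 * Real.pi : ℂ)‖ = 2 * Real.pi := by
    rw [norm_mul, norm_real, Real.norm_of_nonneg Real.pi_pos.le]
    simp
  rw [h2pi] at hnorm
  have hpi := Real.pi_pos
  have hX := norm_nonneg (∑' n : ℕ, a n * (Real.exp (-(n * δ)) : ℂ))
  refine le_of_mul_le_mul_left (a := Real.pi) ?_ hpi
  nlinarith

lemma exists_norm_tsum_logVonMangoldtSubOne_le : ∃ C : ℝ, 0 < C ∧ ∀ δ : ℝ, 0 < δ →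
    ‖∑' n : ℕ, logVonMangoldtSubOne n * Real.exp (-(n * δ))‖ ≤ C / δ := by
  obtain ⟨C, hC, h⟩ := exists_norm_tsum_logVonMangoldtSubOne_le_rpow
  refine ⟨C, hC, fun δ hδ ↦ ?_⟩
  have hcont : Tendsto (fun σ : ℝ ↦ C * δ ^ (-σ)) (𝓝[>] 1) (𝓝 (C * δ ^ (-(1 : ℝ)))) := by
    have : Continuous fun σ : ℝ ↦ C * δ ^ (-σ) :=
      continuous_const.mul (Real.continuous_const_rpow hδ.ne' |>.comp continuous_neg)
    exact (this.tendsto 1).mono_left nhdsWithin_le_nhds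
  rw [Real.rpow_neg_one, ← div_eq_mul_inv] at hcont
  refine ge_of_tendsto hcont ?_
  filter_upwards [Ioc_mem_nhdsGT one_lt_two] with σ hσ
  exact h δ hδ σ hσ.1 hσ.2

open ArithmeticFunction

lemma summable_vonMangoldt_mul_log_sub_div :
    Summable fun n : ℕ ↦ vonMangoldt n * (Real.log n - vonMangoldt n) / n := by
  let i : Nat.Primes × ℕ → ℕ := fun pk ↦ (pk.1 : ℕ) ^ (pk.2 + 1)
  have hi : Function.Injective i := fun a b hab ↦
    Nat.Primes.prodNatEquiv.injective (Subtype.ext hab)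
  refine (hi.summable_iff fun n hn ↦ ?_).mp ?_
  · suffices ¬ IsPrimePow n by simp [vonMangoldt_eq_zero_iff.mpr this]
    intro h
    refine hn ⟨Nat.Primes.prodNatEquiv.symm ⟨n, h⟩, ?_⟩
    exact congrArg Subtype.val (Nat.Primes.prodNatEquiv.apply_symm_apply ⟨n, h⟩)
  have h1 : Summable fun p : Nat.Primes ↦ 32 * (p : ℝ) ^ (-(3 / 2) : ℝ) :=
    (Nat.Primes.summable_rpow.mpr (by norm_num)).mul_left 32
  have h2 : Summable fun k : ℕ ↦ (k : ℝ) * (1 / 2 : ℝ) ^ k := by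
    simpa using summable_pow_mul_geometric_of_norm_lt_one 1 (r := (1 / 2 : ℝ)) (by norm_num)
  refine Summable.of_nonneg_of_le (fun pk ↦ ?_) (fun pk ↦ ?_)
    (h1.mul_of_nonneg h2 (fun p ↦ by positivity) (fun k ↦ by positivity))
  · exact div_nonneg (mul_nonneg vonMangoldt_nonneg (sub_nonneg.mpr vonMangoldt_le_log))
      (Nat.cast_nonneg _)
  · obtain ⟨p, k⟩ := pk
    have hp2 : (2 : ℝ) ≤ p := by exact_mod_cast p.prop.two_le
    have hp0 : (0 : ℝ) < p := by linarith
    have hlog0 : 0 ≤ Real.log p := Real.log_nonneg (by linarith)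
    have hlog := Real.log_le_rpow_div hp0.le (show (0 : ℝ) < 1 / 4 by norm_num)
    have hsq : Real.log p ^ 2 ≤ 16 * (p : ℝ) ^ (1 / 2 : ℝ) := by
      calc Real.log p ^ 2 ≤ ((p : ℝ) ^ (1 / 4 : ℝ) / (1 / 4)) ^ 2 := by gcongr
        _ = 16 * ((p : ℝ) ^ (1 / 4 : ℝ) * (p : ℝ) ^ (1 / 4 : ℝ)) := by ring
        _ = _ := by
          rw [← Real.rpow_add hp0]
          norm_num
    simp only [Function.comp_apply, i]
    rw [vonMangoldt_apply_pow (Nat.succ_ne_zero k), vonMangoldt_apply_prime p.prop,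
      Nat.cast_pow, Real.log_pow]
    push_cast
    rcases Nat.eq_zero_or_pos k with rfl | hk
    · simp
    obtain ⟨j, rfl⟩ := Nat.exists_eq_add_of_le' hk
    have hj : ((p : ℝ) ^ j)⁻¹ ≤ (1 / 2) ^ j := by
      rw [one_div, inv_pow]
      gcongr
    have hrp : (p : ℝ) ^ (1 / 2 : ℝ) * ((p : ℝ) ^ 2)⁻¹ = (p : ℝ) ^ (-(3 / 2) : ℝ) := by
      rw [← Real.rpow_natCast, ← Real.rpow_neg hp0.le, ← Real.rpow_add hp0]
      norm_num
    rw [← hrp]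
    push_cast
    calc _ = ((j : ℝ) + 1) * Real.log p ^ 2 * (((p : ℝ) ^ j)⁻¹ * ((p : ℝ) ^ 2)⁻¹) := by
          field_simp
          ring
      _ ≤ ((j : ℝ) + 1) * (16 * (p : ℝ) ^ (1 / 2 : ℝ)) * ((1 / 2) ^ j * ((p : ℝ) ^ 2)⁻¹) := by
          gcongr
      _ = _ := by ring

lemma exists_tsum_vonMangoldt_mul_log_sub_le : ∃ C : ℝ, 0 ≤ C ∧ ∀ δ : ℝ, 0 < δ →
    |∑' n : ℕ, vonMangoldt n * (Real.log n - vonMangoldt n) * Real.exp (-(n * δ))| ≤ C / δ := by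
  have h0 (n : ℕ) : 0 ≤ vonMangoldt n * (Real.log n - vonMangoldt n) :=
    mul_nonneg vonMangoldt_nonneg (sub_nonneg.mpr vonMangoldt_le_log)
  have hS := summable_vonMangoldt_mul_log_sub_div
  refine ⟨∑' n : ℕ, vonMangoldt n * (Real.log n - vonMangoldt n) / n,
    tsum_nonneg fun n ↦ div_nonneg (h0 n) n.cast_nonneg, fun δ hδ ↦ ?_⟩
  rw [abs_of_nonneg (tsum_nonneg fun n ↦ mul_nonneg (h0 n) (Real.exp_pos _).le), ← tsum_div_const]
  have hle (n : ℕ) : vonMangoldt n * (Real.log n - vonMangoldt n) * Real.exp (-(n * δ)) ≤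
      vonMangoldt n * (Real.log n - vonMangoldt n) / n / δ := by
    rcases eq_or_ne n 0 with rfl | hn
    · simp
    have hn0 : (0 : ℝ) < n := by exact_mod_cast Nat.pos_of_ne_zero hn
    rw [div_div, div_eq_mul_inv, Real.exp_neg]
    have := h0 n
    gcongr
    linarith [Real.add_one_le_exp ((n : ℝ) * δ)]
  exact Summable.tsum_le_tsum hle
    ((hS.div_const δ).of_nonneg_of_le (fun n ↦ mul_nonneg (h0 n) (Real.exp_pos _).le) hle)
    (hS.div_const δ)

lemma hasSum_harmonic_mul_pow {q : ℝ} (h0 : 0 ≤ q) (h1 : q < 1) :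
    HasSum (fun n : ℕ ↦ (harmonic n : ℝ) * q ^ n) (-Real.log (1 - q) / (1 - q)) := by
  have hq : |q| < 1 := by rwa [abs_of_nonneg h0]
  have hL := Real.hasSum_pow_div_log_of_abs_lt_one hq
  have hL0 : HasSum (fun n : ℕ ↦ q ^ n / n) (-Real.log (1 - q)) := by
    rw [hasSum_nat_add_iff' 1 |>.symm]
    simpa using hL
  have hG := hasSum_geometric_of_lt_one h0 h1
  have hn1 : Summable fun n : ℕ ↦ ‖q ^ n / n‖ := hL0.summable.norm
  have hn2 : Summable fun n : ℕ ↦ ‖q ^ n‖ := hG.summable.norm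
  have h := hasSum_sum_range_mul_of_summable_norm hn1 hn2
  rw [hL0.tsum_eq, hG.tsum_eq, ← div_eq_mul_inv] at h
  refine (congrArg (HasSum · _) (funext fun n ↦ ?_)).mpr h
  rw [Finset.sum_range_succ', harmonic, Rat.cast_sum, Finset.sum_mul]
  simp only [Nat.cast_zero, div_zero, zero_mul, add_zero]
  refine Finset.sum_congr rfl fun i hi ↦ ?_
  have hle : i + 1 ≤ n := Finset.mem_range.mp hi
  rw [div_mul_eq_mul_div, ← pow_add, Nat.add_sub_cancel' hle]
  push_cast
  ring

lemma abs_log_sub_harmonic_le (n : ℕ) : |Real.log n - harmonic n| ≤ 1 := by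
  rcases eq_or_ne n 0 with rfl | hn
  · simp
  have h1 := harmonic_le_one_add_log n
  have h2 := log_add_one_le_harmonic n
  have h3 : Real.log n ≤ Real.log (n + 1 : ℕ) :=
    Real.log_le_log (by exact_mod_cast Nat.pos_of_ne_zero hn) (by push_cast; linarith)
  rw [abs_le]
  constructor <;> linarith

lemma exists_tsum_log_mul_exp_sub_le : ∃ C : ℝ, 0 ≤ C ∧ ∀ δ : ℝ, 0 < δ → δ ≤ 1 →
    |∑' n : ℕ, Real.log n * Real.exp (-(n * δ)) - δ⁻¹ * Real.log δ⁻¹| ≤ C / δ := by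
  refine ⟨5, by norm_num, fun δ hδ hδ1 ↦ ?_⟩
  set q := Real.exp (-δ) with hq
  have hq0 : 0 ≤ q := (Real.exp_pos _).le
  have hq1 : q < 1 := Real.exp_zero ▸ Real.exp_lt_exp.mpr (by linarith)
  have hpow (n : ℕ) : Real.exp (-(n * δ)) = q ^ n := by
    rw [hq, ← Real.exp_nat_mul]
    ring_nf
  simp_rw [hpow]
  have hH := hasSum_harmonic_mul_pow hq0 hq1
  have hG := hasSum_geometric_of_lt_one hq0 hq1
  have hb (n : ℕ) : ‖(Real.log n - harmonic n) * q ^ n‖ ≤ q ^ n := by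
    rw [norm_mul, Real.norm_of_nonneg (pow_nonneg hq0 n)]
    exact mul_le_of_le_one_left (pow_nonneg hq0 n) (abs_log_sub_harmonic_le n)
  have hD : Summable fun n : ℕ ↦ (Real.log n - harmonic n) * q ^ n :=
    Summable.of_norm_bounded hG.summable hb
  have hDle := tsum_of_norm_bounded hG hb
  have hsum : ∑' n : ℕ, Real.log n * q ^ n =
      (∑' n : ℕ, (Real.log n - harmonic n) * q ^ n) + -Real.log (1 - q) / (1 - q) := by
    rw [← hH.tsum_eq, ← hD.tsum_add hH.summable]
    exact tsum_congr fun n ↦ by ring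
  have hlow : δ / 2 ≤ 1 - q := by
    have h := Real.add_one_le_exp δ
    have : q ≤ (δ + 1)⁻¹ := by
      rw [hq, Real.exp_neg]
      gcongr
    have h2 : (δ + 1)⁻¹ ≤ 1 - δ / 2 := by
      rw [inv_le_iff_one_le_mul₀ (by linarith)]
      nlinarith
    linarith
  have hup : 1 - q ≤ δ := by linarith [Real.add_one_le_exp (-δ)]
  have hinv : (1 - q)⁻¹ ≤ δ⁻¹ + 1 := by
    have h := Real.add_one_le_exp δ
    have h2 : q ≤ (δ + 1)⁻¹ := by
      rw [hq, Real.exp_neg]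
      gcongr
    have h3 : δ / (δ + 1) ≤ 1 - q := by
      have : δ / (δ + 1) = 1 - (δ + 1)⁻¹ := by field_simp; ring
      linarith
    calc (1 - q)⁻¹ ≤ (δ / (δ + 1))⁻¹ := by gcongr
      _ = _ := by
        field_simp
        ring
  have hinv' : δ⁻¹ ≤ (1 - q)⁻¹ := by
    gcongr
  have hlog1 : Real.log δ⁻¹ ≤ -Real.log (1 - q) := by
    rw [Real.log_inv]
    have := Real.log_le_log (by linarith) hup
    linarith
  have hlog2 : -Real.log (1 - q) ≤ Real.log δ⁻¹ + 1 := by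
    rw [Real.log_inv]
    have h := Real.log_le_log (by linarith) hlow
    rw [Real.log_div hδ.ne' (by norm_num)] at h
    linarith [Real.log_two_lt_d9]
  have hinv1 : 1 ≤ δ⁻¹ := (one_le_inv₀ hδ).mpr hδ1
  have hl0 : 0 ≤ Real.log δ⁻¹ := Real.log_nonneg hinv1
  have hl1 : Real.log δ⁻¹ ≤ δ⁻¹ := by
    linarith [Real.log_le_sub_one_of_pos (inv_pos.mpr hδ)]
  rw [Real.norm_eq_abs, abs_le] at hDle
  rw [hsum, div_eq_mul_inv, div_eq_mul_inv, abs_le]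
  generalize Real.log δ⁻¹ = l at *
  generalize -Real.log (1 - q) = m at *
  generalize (1 - q)⁻¹ = u at *
  generalize δ⁻¹ = v at *
  have hm : v * l ≤ m * u := by nlinarith
  have hm2 : m * u ≤ (l + 1) * (v + 1) := by
    apply mul_le_mul <;> linarith
  constructor <;> nlinarith

lemma exists_abs_tsum_log_mul_vonMangoldt_sub_one_le : ∃ C : ℝ, 0 < C ∧ ∀ δ : ℝ, 0 < δ →
    |∑' n : ℕ, Real.log n * (vonMangoldt n - 1) * Real.exp (-(n * δ))| ≤ C / δ := by
  obtain ⟨C, hC, h⟩ := exists_norm_tsum_logVonMangoldtSubOne_le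
  refine ⟨C, hC, fun δ hδ ↦ ?_⟩
  have := h δ hδ
  rw [← Real.norm_eq_abs, ← norm_real, ofReal_tsum]
  convert this using 4 with n
  simp [logVonMangoldtSubOne, LSeries.logMul, natCast_log]

lemma summable_mul_exp_of_abs_le_sq {f : ℕ → ℝ} (hf : ∀ n : ℕ, |f n| ≤ (n : ℝ) ^ 2) {δ : ℝ}
    (hδ : 0 < δ) : Summable fun n : ℕ ↦ f n * Real.exp (-(n * δ)) := by
  have hq : ‖Real.exp (-δ)‖ < 1 := by
    rw [Real.norm_of_nonneg (Real.exp_pos _).le]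
    exact Real.exp_zero ▸ Real.exp_lt_exp.mpr (by linarith)
  refine Summable.of_norm_bounded (summable_pow_mul_geometric_of_norm_lt_one 2 hq) fun n ↦ ?_
  rw [norm_mul, Real.norm_of_nonneg (Real.exp_pos _).le, ← Real.exp_nat_mul, Real.norm_eq_abs,
    mul_neg]
  exact mul_le_mul_of_nonneg_right (hf n) (Real.exp_pos _).le

lemma exists_tsum_vonMangoldt_sq_mul_exp_sub_le : ∃ C : ℝ, 0 < C ∧ ∀ δ : ℝ, 0 < δ → δ ≤ 1 →
    |∑' n : ℕ, vonMangoldt n ^ 2 * Real.exp (-(n * δ)) - δ⁻¹ * Real.log δ⁻¹| ≤ C / δ := by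
  obtain ⟨A, hA, h1⟩ := exists_abs_tsum_log_mul_vonMangoldt_sub_one_le
  obtain ⟨B, hB, h2⟩ := exists_tsum_log_mul_exp_sub_le
  obtain ⟨D, hD, h3⟩ := exists_tsum_vonMangoldt_mul_log_sub_le
  refine ⟨A + B + D, by positivity, fun δ hδ hδ1 ↦ ?_⟩
  have hlog (n : ℕ) : Real.log n ≤ n := Real.log_le_self n.cast_nonneg
  have hlog0 (n : ℕ) : 0 ≤ Real.log n := Real.log_natCast_nonneg n
  have hΛ0 (n : ℕ) : 0 ≤ vonMangoldt n := vonMangoldt_nonneg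
  have hΛ (n : ℕ) : vonMangoldt n ≤ Real.log n := vonMangoldt_le_log
  have hle (n : ℕ) : Real.log n * 1 ≤ (n : ℝ) ^ 2 := by
    rcases eq_or_ne n 0 with rfl | hn
    · simp
    have hn1 : (1 : ℝ) ≤ n := by exact_mod_cast Nat.pos_of_ne_zero hn
    nlinarith [hlog n]
  have hle2 (n : ℕ) : Real.log n ^ 2 ≤ (n : ℝ) ^ 2 := by
    have := hlog n
    have := hlog0 n
    gcongr
  have s1 := summable_mul_exp_of_abs_le_sq (f := fun n ↦ Real.log n * (vonMangoldt n - 1))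
    (fun n ↦ by
      rw [abs_le]
      constructor <;> nlinarith [hle n, hle2 n, hlog0 n, hΛ0 n, hΛ n]) hδ
  have s2 := summable_mul_exp_of_abs_le_sq (f := fun n ↦ Real.log n)
    (fun n ↦ by
      rw [abs_of_nonneg (hlog0 n)]
      linarith [hle n]) hδ
  have s3 := summable_mul_exp_of_abs_le_sq
    (f := fun n ↦ vonMangoldt n * (Real.log n - vonMangoldt n))
    (fun n ↦ by
      rw [abs_le]
      constructor <;> nlinarith [hle2 n, hlog0 n, hΛ0 n, hΛ n]) hδ
  have hsum : ∑' n : ℕ, vonMangoldt n ^ 2 * Real.exp (-(n * δ)) =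
      (∑' n : ℕ, Real.log n * (vonMangoldt n - 1) * Real.exp (-(n * δ))) +
        (∑' n : ℕ, Real.log n * Real.exp (-(n * δ))) -
        ∑' n : ℕ, vonMangoldt n * (Real.log n - vonMangoldt n) * Real.exp (-(n * δ)) := by
    rw [← s1.tsum_add s2, ← (s1.add s2).tsum_sub s3]
    exact tsum_congr fun n ↦ by ring
  have h1 := abs_le.mp (h1 δ hδ)
  have h2 := abs_le.mp (h2 δ hδ hδ1)
  have h3 := abs_le.mp (h3 δ hδ)
  rw [hsum, add_div, add_div, abs_le]
  constructor <;> linarith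

end

theorem vonMangoldt_sq_weighted_sum :
    ∃ C : ℝ, 0 < C ∧ ∃ N₀ : ℕ, ∀ N : ℕ, N₀ ≤ N →
      |(∑' m : ℕ, vM m ^ 2 * Real.exp (-2 * m / N)) - (N : ℝ) / 2 * Real.log N|
        ≤ C * N := by
  obtain ⟨C, hC, h⟩ := exists_tsum_vonMangoldt_sq_mul_exp_sub_le
  refine ⟨C + 1, by positivity, 2, fun N hN ↦ ?_⟩
  have hN2 : (2 : ℝ) ≤ N := by exact_mod_cast hN
  have hN0 : (0 : ℝ) < N := by linarith
  have h1 := h (2 / N) (by positivity) ((div_le_one hN0).mpr hN2)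
  have hsum : ∑' m : ℕ, vM m ^ 2 * Real.exp (-2 * m / N) =
      ∑' m : ℕ, ArithmeticFunction.vonMangoldt m ^ 2 * Real.exp (-(m * (2 / N))) :=
    tsum_congr fun m ↦ by
      rw [vM]
      congr 2
      ring
  rw [← hsum, inv_div, Real.log_div hN0.ne' two_ne_zero, div_div_eq_mul_div] at h1
  have hl0 := Real.log_nonneg one_le_two
  have hl1 : Real.log 2 ≤ 1 := by linarith [Real.log_two_lt_d9]
  rw [abs_le] at h1 ⊢
  constructor <;> nlinarith
end
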